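/- arXiv:1410.5105 — 4 statements merged into one kernel-verified Lean document; each statement's English description precedes it below -/
import Mathlib

section
/- Existence of a good radius (Corollary of the region-growing lemma): in the region-growing setup (edge version), let additionally H ⊆ E with ℓ(H) := Σ_{(u,v)∈H} ℓ(u,v) > 0, let α ∈ (0,1), and let 0 ≤ a < b. Define ∂H(ρ) = {(u,v) ∈ H : u,v ∈ S and exactly one of u,v lies in B(ρ)}. Then there exists ρ₁ ∈ [a,b) satisfying simultaneously: (1) c(∂F(ρ₁)) ≤ (2/((1−α)(b−a))) · Vol(ρ₁) · ln( e·Vol(b)/Vol(ρ₁) ) · ln ln( e·Vol(b)/Vol(a) ); (2) c(∂F(ρ₁)) ≤ (2/((1−α)(b−a))) · cVol(ρ₁) · ln( e·cVol(a)/cVol(ρ₁) ) · ln ln( e·cVol(a)/cVol(b) ); and (3) |∂H(ρ₁)| < ℓ(H)/(α(b−a)). -/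
open scoped Classical

namespace RegionGrow

variable {V : Type*}

/-- The ball `B^S_ℓ(z,ρ)`: vertices of `S` at `ℓ`-distance at most `ρ` from `z`. -/
noncomputable def ball (ℓ : V → V → ℝ) (S : Finset V) (z : V) (ρ : ℝ) : Finset V :=
  S.filter fun v => ℓ z v ≤ ρ

/-- The boundary `∂^{S,F}_ℓ(z,ρ)`: edges of `F` with both endpoints in `S`, exactly one
of which lies in the ball of radius `ρ` around `z`. -/
noncomputable def bdry (ℓ : V → V → ℝ) (S : Finset V) (F : Finset (V × V)) (z : V) (ρ : ℝ) :
    Finset (V × V) :=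
  F.filter fun p => p.1 ∈ S ∧ p.2 ∈ S ∧ ¬ ((ℓ z p.1 ≤ ρ) ↔ (ℓ z p.2 ≤ ρ))

/-- The volume `𝒱^{S,F}_ℓ(β; z, ρ)`.  For a crossing edge, the endpoint inside the ball
is the one closer to `z`, so its distance to `z` is `min (ℓ z u) (ℓ z v)`. -/
noncomputable def vol (c : V × V → ℝ) (ℓ : V → V → ℝ) (S : Finset V) (F : Finset (V × V))
    (z : V) (β ρ : ℝ) : ℝ :=
  β + ∑ p ∈ F.filter (fun p => p.1 ∈ ball ℓ S z ρ ∧ p.2 ∈ ball ℓ S z ρ), c p * ℓ p.1 p.2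
    + ∑ p ∈ bdry ℓ S F z ρ, c p * (ρ - min (ℓ z p.1) (ℓ z p.2))

/-- The complementary volume `𝒱̄^{S,F}_ℓ(β; z, ρ)`.  For a crossing edge, the endpoint
outside the ball is the one farther from `z`, at distance `max (ℓ z u) (ℓ z v)`. -/
noncomputable def cvol (c : V × V → ℝ) (ℓ : V → V → ℝ) (S : Finset V) (F : Finset (V × V))
    (z : V) (β ρ : ℝ) : ℝ :=
  β + ∑ p ∈ F.filter
        (fun p => p.1 ∈ S ∧ p.1 ∉ ball ℓ S z ρ ∧ p.2 ∈ S ∧ p.2 ∉ ball ℓ S z ρ),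
        c p * ℓ p.1 p.2
    + ∑ p ∈ bdry ℓ S F z ρ, c p * (max (ℓ z p.1) (ℓ z p.2) - ρ)

open MeasureTheory Set in
theorem key (g : ℝ → ℝ) (a b K : ℝ) (hab : a < b) (hK : 0 < K) (hg : MonotoneOn g (Icc a b)) :
    (volume.restrict (Ioo a b)) {x | K * (g b - g a) < deriv g x} < ENNReal.ofReal (1 / K) := by
  set μ := volume.restrict (Ioo a b) with hμ
  have hgab : g a ≤ g b := hg (by simp [hab.le]) (by simp [hab.le]) hab.le
  by_cases h0 : μ {x | K * (g b - g a) < deriv g x} = 0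
  · rw [h0]; simpa using hK
  have hg' : MonotoneOn g (uIcc a b) := by rwa [uIcc_of_le hab.le]
  have hint : Integrable (deriv g) μ :=
    ((intervalIntegrable_iff_integrableOn_Ioo_of_le hab.le).1 hg'.intervalIntegrable_deriv)
  have h1 := setIntegral_gt_gt (μ := μ) (R := K * (g b - g a)) (f := deriv g)
    (by have : 0 ≤ g b - g a := by linarith
        positivity) hint.integrableOn h0
  have hnn : 0 ≤ᵐ[μ] deriv g := by
    rw [hμ, Filter.EventuallyLE, ae_restrict_iff' measurableSet_Ioo]
    refine Filter.Eventually.of_forall fun x hx => ?_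
    rw [← derivWithin_of_isOpen isOpen_Ioo hx]
    exact (hg.mono Ioo_subset_Icc_self).derivWithin_nonneg
  have h2 := setIntegral_le_integral (s := {x | K * (g b - g a) < deriv g x}) hint hnn
  have h3 := hg'.intervalIntegral_deriv_mem_uIcc
  rw [uIcc_of_le (by linarith), intervalIntegral.integral_of_le hab.le,
    integral_Ioc_eq_integral_Ioo] at h3
  have h4 : μ.real {x | K * (g b - g a) < deriv g x} * (K * (g b - g a)) < g b - g a :=
    h1.trans_le (h2.trans h3.2)
  have hpos : 0 < g b - g a := by
    rcases (sub_nonneg.2 hgab).eq_or_lt with h | h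
    · rw [← h] at h4; simp at h4
    · exact h
  have h5 : μ.real {x | K * (g b - g a) < deriv g x} < 1 / K := by
    rw [lt_div_iff₀ hK]
    by_contra hh
    push Not at hh
    nlinarith
  have hfin : μ {x | K * (g b - g a) < deriv g x} ≠ ⊤ := measure_ne_top _ _
  rw [← ENNReal.ofReal_toReal hfin]
  exact (ENNReal.ofReal_lt_ofReal_iff (by positivity)).2 h5

theorem abs_sub_le' (ℓ : V → V → ℝ) (hℓsymm : ∀ u v, ℓ u v = ℓ v u)
    (hℓtri : ∀ u v w, ℓ u w ≤ ℓ u v + ℓ v w) (z u v : V) :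
    max (ℓ z u) (ℓ z v) - min (ℓ z u) (ℓ z v) ≤ ℓ u v := by
  have h1 := hℓtri z u v
  have h2 := hℓtri z v u
  have h3 := hℓsymm u v
  rcases le_total (ℓ z u) (ℓ z v) with h | h <;> simp [h] <;> linarith

theorem vol_eq (c : V × V → ℝ) (ℓ : V → V → ℝ) (S : Finset V) (F : Finset (V × V))
    (z : V) (β ρ : ℝ) : vol c ℓ S F z β ρ = β + ∑ p ∈ F, c p *
      (if p.1 ∈ S ∧ p.2 ∈ S then
        (if max (ℓ z p.1) (ℓ z p.2) ≤ ρ then ℓ p.1 p.2 else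
          if min (ℓ z p.1) (ℓ z p.2) ≤ ρ then ρ - min (ℓ z p.1) (ℓ z p.2) else 0) else 0) := by
  unfold vol bdry ball
  rw [Finset.sum_filter, Finset.sum_filter, add_assoc, ← Finset.sum_add_distrib]
  congr 1
  refine Finset.sum_congr rfl fun p _ => ?_
  simp only [Finset.mem_filter, max_le_iff, min_le_iff]
  by_cases h1 : p.1 ∈ S <;> by_cases h2 : p.2 ∈ S <;> by_cases h3 : ℓ z p.1 ≤ ρ <;>
    by_cases h4 : ℓ z p.2 ≤ ρ <;> simp [h1, h2, h3, h4]

theorem cvol_eq (c : V × V → ℝ) (ℓ : V → V → ℝ) (S : Finset V) (F : Finset (V × V))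
    (z : V) (β ρ : ℝ) : cvol c ℓ S F z β ρ = β + ∑ p ∈ F, c p *
      (if p.1 ∈ S ∧ p.2 ∈ S then
        (if max (ℓ z p.1) (ℓ z p.2) ≤ ρ then 0 else
          if min (ℓ z p.1) (ℓ z p.2) ≤ ρ then max (ℓ z p.1) (ℓ z p.2) - ρ else ℓ p.1 p.2)
        else 0) := by
  unfold cvol bdry ball
  rw [Finset.sum_filter, Finset.sum_filter, add_assoc, ← Finset.sum_add_distrib]
  congr 1
  refine Finset.sum_congr rfl fun p _ => ?_
  simp only [Finset.mem_filter, max_le_iff, min_le_iff]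
  by_cases h1 : p.1 ∈ S <;> by_cases h2 : p.2 ∈ S <;> by_cases h3 : ℓ z p.1 ≤ ρ <;>
    by_cases h4 : ℓ z p.2 ≤ ρ <;> simp [h1, h2, h3, h4]

section
variable {c : V × V → ℝ} (hc : ∀ p, 0 ≤ c p)
    {ℓ : V → V → ℝ} (hℓnn : ∀ u v, 0 ≤ ℓ u v)
    (hℓsymm : ∀ u v, ℓ u v = ℓ v u)
    (hℓtri : ∀ u v w, ℓ u w ≤ ℓ u v + ℓ v w)
    (S : Finset V) (F : Finset (V × V)) (z : V) {β : ℝ} (hβ : 0 < β)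

theorem vol_pos (hc : ∀ p, 0 ≤ c p) (hℓnn : ∀ u v, 0 ≤ ℓ u v) (hβ : 0 < β) (ρ : ℝ) :
    0 < vol c ℓ S F z β ρ := by
  rw [vol_eq]
  refine add_pos_of_pos_of_nonneg hβ (Finset.sum_nonneg fun p _ => mul_nonneg (hc p) ?_)
  have := hℓnn p.1 p.2
  split_ifs <;> linarith

theorem cvol_pos (hc : ∀ p, 0 ≤ c p) (hℓnn : ∀ u v, 0 ≤ ℓ u v) (hβ : 0 < β) (ρ : ℝ) :
    0 < cvol c ℓ S F z β ρ := by
  rw [cvol_eq]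
  refine add_pos_of_pos_of_nonneg hβ (Finset.sum_nonneg fun p _ => mul_nonneg (hc p) ?_)
  have := hℓnn p.1 p.2
  split_ifs <;> linarith

theorem vol_mono (hc : ∀ p, 0 ≤ c p) (hℓnn : ∀ u v, 0 ≤ ℓ u v)
    (hℓsymm : ∀ u v, ℓ u v = ℓ v u) (hℓtri : ∀ u v w, ℓ u w ≤ ℓ u v + ℓ v w) (β : ℝ) :
    Monotone (vol c ℓ S F z β) := by
  intro x y hxy
  rw [vol_eq, vol_eq]
  refine add_le_add le_rfl (Finset.sum_le_sum fun p _ => mul_le_mul_of_nonneg_left ?_ (hc p))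
  have h1 := hℓnn p.1 p.2
  have h2 := abs_sub_le' ℓ hℓsymm hℓtri z p.1 p.2
  split_ifs <;> linarith

theorem cvol_anti (hc : ∀ p, 0 ≤ c p) (hℓnn : ∀ u v, 0 ≤ ℓ u v)
    (hℓsymm : ∀ u v, ℓ u v = ℓ v u) (hℓtri : ∀ u v w, ℓ u w ≤ ℓ u v + ℓ v w) (β : ℝ) :
    Antitone (cvol c ℓ S F z β) := by
  intro x y hxy
  rw [cvol_eq, cvol_eq]
  refine add_le_add le_rfl (Finset.sum_le_sum fun p _ => mul_le_mul_of_nonneg_left ?_ (hc p))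
  have h1 := hℓnn p.1 p.2
  have h2 := abs_sub_le' ℓ hℓsymm hℓtri z p.1 p.2
  split_ifs <;> linarith

end

theorem ev_iff [Finite V] (ℓ : V → V → ℝ) (z : V) (ρ : ℝ) (hρ : ∀ v, ℓ z v ≠ ρ) :
    ∀ᶠ x in nhds ρ, ∀ v, (ℓ z v ≤ x ↔ ℓ z v ≤ ρ) := by
  rw [Filter.eventually_all]
  intro v
  rcases lt_or_gt_of_ne (hρ v) with h | h
  · filter_upwards [lt_mem_nhds h] with x hx
    simp [hx.le, h.le]
  · filter_upwards [gt_mem_nhds h] with x hx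
    exact ⟨fun h' => absurd hx (not_lt.2 h'), fun h' => absurd h (not_lt.2 h')⟩

theorem vol_deriv [Finite V] (c : V × V → ℝ) (ℓ : V → V → ℝ) (S : Finset V)
    (F : Finset (V × V)) (z : V) (β ρ : ℝ) (hρ : ∀ v, ℓ z v ≠ ρ) :
    HasDerivAt (vol c ℓ S F z β) (∑ p ∈ bdry ℓ S F z ρ, c p) ρ := by
  have h : HasDerivAt (fun x => β + ∑ p ∈ F.filter (fun p => p.1 ∈ ball ℓ S z ρ ∧
      p.2 ∈ ball ℓ S z ρ), c p * ℓ p.1 p.2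
      + ∑ p ∈ bdry ℓ S F z ρ, c p * (x - min (ℓ z p.1) (ℓ z p.2)))
      (∑ p ∈ bdry ℓ S F z ρ, c p) ρ := by
    refine HasDerivAt.const_add _ (HasDerivAt.fun_sum fun p _ => ?_)
    simpa using ((hasDerivAt_id ρ).sub_const (min (ℓ z p.1) (ℓ z p.2))).const_mul (c p)
  refine h.congr_of_eventuallyEq ?_
  filter_upwards [ev_iff ℓ z ρ hρ] with x hx
  have e1 : ball ℓ S z x = ball ℓ S z ρ := by
    ext p; simp only [ball, Finset.mem_filter, hx]
  have e2 : bdry ℓ S F z x = bdry ℓ S F z ρ := by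
    ext p; simp only [bdry, Finset.mem_filter, hx]
  simp only [vol]
  rw [e1, e2]

theorem cvol_deriv [Finite V] (c : V × V → ℝ) (ℓ : V → V → ℝ) (S : Finset V)
    (F : Finset (V × V)) (z : V) (β ρ : ℝ) (hρ : ∀ v, ℓ z v ≠ ρ) :
    HasDerivAt (cvol c ℓ S F z β) (-∑ p ∈ bdry ℓ S F z ρ, c p) ρ := by
  have h : HasDerivAt (fun x => β + ∑ p ∈ F.filter
        (fun p => p.1 ∈ S ∧ p.1 ∉ ball ℓ S z ρ ∧ p.2 ∈ S ∧ p.2 ∉ ball ℓ S z ρ),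
        c p * ℓ p.1 p.2
      + ∑ p ∈ bdry ℓ S F z ρ, c p * (max (ℓ z p.1) (ℓ z p.2) - x))
      (-∑ p ∈ bdry ℓ S F z ρ, c p) ρ := by
    rw [← Finset.sum_neg_distrib]
    refine HasDerivAt.const_add _ (HasDerivAt.fun_sum fun p _ => ?_)
    simpa using ((hasDerivAt_id ρ).const_sub (max (ℓ z p.1) (ℓ z p.2))).const_mul (c p)
  refine h.congr_of_eventuallyEq ?_
  filter_upwards [ev_iff ℓ z ρ hρ] with x hx
  have e1 : ball ℓ S z x = ball ℓ S z ρ := by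
    ext p; simp only [ball, Finset.mem_filter, hx]
  have e2 : bdry ℓ S F z x = bdry ℓ S F z ρ := by
    ext p; simp only [bdry, Finset.mem_filter, hx]
  simp only [cvol]
  rw [e1, e2]

open MeasureTheory Set in
theorem bad3 (ℓ : V → V → ℝ) (hℓsymm : ∀ u v, ℓ u v = ℓ v u) (hℓnn : ∀ u v, 0 ≤ ℓ u v)
    (hℓtri : ∀ u v w, ℓ u w ≤ ℓ u v + ℓ v w) (S : Finset V) (H : Finset (V × V)) (z : V)
    (hH : 0 < ∑ p ∈ H, ℓ p.1 p.2) (t : ℝ) (ht : 0 < t) :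
    volume {ρ : ℝ | (∑ p ∈ H, ℓ p.1 p.2) / t ≤ ((bdry ℓ S H z ρ).card : ℝ)}
      ≤ ENNReal.ofReal t := by
  set L := ∑ p ∈ H, ℓ p.1 p.2 with hL
  let f : ℝ → ENNReal := fun ρ => ∑ p ∈ H,
    (Ico (min (ℓ z p.1) (ℓ z p.2)) (max (ℓ z p.1) (ℓ z p.2))).indicator 1 ρ
  have hf : Measurable f := by
    refine Finset.measurable_fun_sum _ fun p _ => ?_
    exact measurable_one.indicator measurableSet_Ico
  have hfi : ∫⁻ ρ, f ρ ≤ ENNReal.ofReal L := by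
    rw [lintegral_finsetSum _ (fun p _ => measurable_one.indicator measurableSet_Ico), hL,
      ENNReal.ofReal_sum_of_nonneg (fun p _ => hℓnn _ _)]
    refine Finset.sum_le_sum fun p _ => ?_
    rw [lintegral_indicator_one measurableSet_Ico, Real.volume_Ico]
    exact ENNReal.ofReal_le_ofReal (abs_sub_le' ℓ hℓsymm hℓtri z p.1 p.2)
  have hcard : ∀ ρ, ((bdry ℓ S H z ρ).card : ENNReal) ≤ f ρ := by
    intro ρ
    rw [Finset.card_eq_sum_ones, Nat.cast_sum]
    unfold bdry
    rw [Finset.sum_filter]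
    refine Finset.sum_le_sum fun p _ => ?_
    split_ifs with h
    · rw [indicator_of_mem]
      · simp
      · simp only [mem_Ico, min_le_iff, lt_max_iff]
        rw [← not_le, ← not_le]
        tauto
    · simp
  have hm := mul_meas_ge_le_lintegral (μ := volume) hf (ENNReal.ofReal (L / t))
  have hsub : {ρ : ℝ | L / t ≤ ((bdry ℓ S H z ρ).card : ℝ)} ⊆
      {ρ | ENNReal.ofReal (L / t) ≤ f ρ} := by
    intro ρ hρ
    refine le_trans ?_ (hcard ρ)
    rw [← ENNReal.ofReal_natCast]
    exact ENNReal.ofReal_le_ofReal hρ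
  have h1 : ENNReal.ofReal (L / t) * volume {ρ : ℝ | L / t ≤ ((bdry ℓ S H z ρ).card : ℝ)} ≤
      ENNReal.ofReal (L / t) * ENNReal.ofReal t := by
    rw [← ENNReal.ofReal_mul (by positivity), div_mul_cancel₀ _ ht.ne']
    exact (mul_le_mul_right (measure_mono hsub) _).trans (hm.trans hfi)
  exact (ENNReal.mul_le_mul_iff_right (by simpa using div_pos hH ht) ENNReal.ofReal_ne_top).1 h1

theorem one_le_log {x y : ℝ} (hx : 0 < x) (hxy : x ≤ y) : 1 ≤ Real.log (Real.exp 1 * y / x) := by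
  rw [Real.le_log_iff_exp_le (by have := hx.trans_le hxy; positivity), le_div_iff₀ hx]
  exact mul_le_mul_of_nonneg_left hxy (Real.exp_pos 1).le

theorem loglog_le {x y w : ℝ} (hx : 0 < x) (hxy : x ≤ y) (hyw : y ≤ w) :
    Real.log (Real.log (Real.exp 1 * w / y)) ≤ Real.log (Real.log (Real.exp 1 * w / x)) := by
  have hy := hx.trans_le hxy
  have hw := hy.trans_le hyw
  refine Real.log_le_log (by linarith [one_le_log hy hyw]) (Real.log_le_log (by positivity) ?_)
  gcongr

theorem loglog_deriv {f : ℝ → ℝ} {f' x w : ℝ} (hf : HasDerivAt f f' x) (hx : 0 < f x)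
    (hw : f x ≤ w) :
    HasDerivAt (fun t => Real.log (Real.log (Real.exp 1 * w / f t)))
      (-f' / (f x * Real.log (Real.exp 1 * w / f x))) x := by
  have hw0 := hx.trans_le hw
  have h1 := one_le_log hx hw
  have h := (((hasDerivAt_const x (Real.exp 1 * w)).fun_div hf hx.ne').log
    (by positivity)).log (by linarith)
  convert h using 1
  field_simp
  ring

/-- Existence of a good radius: there is `ρ₁ ∈ [a,b)` for which the
boundary cost is bounded by the ball volume and by the complementary volume
(each times the corresponding logarithmic factors), while the number of `H`-edges
crossing the ball is less than `ℓ(H)/(α(b-a))`. -/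
theorem stmt_6 [Fintype V] (E F H : Finset (V × V)) (hFE : F ⊆ E) (hHE : H ⊆ E)
    (c : V × V → ℝ) (hc : ∀ p, 0 ≤ c p)
    (ℓ : V → V → ℝ) (hℓ0 : ∀ v, ℓ v v = 0) (hℓnn : ∀ u v, 0 ≤ ℓ u v)
    (hℓsymm : ∀ u v, ℓ u v = ℓ v u)
    (hℓtri : ∀ u v w, ℓ u w ≤ ℓ u v + ℓ v w)
    (hH : 0 < ∑ p ∈ H, ℓ p.1 p.2)
    (α : ℝ) (hα0 : 0 < α) (hα1 : α < 1)
    (S : Finset V) (z : V) (β : ℝ) (hβ : 0 < β)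
    (a b : ℝ) (ha : 0 ≤ a) (hab : a < b) :
    ∃ ρ₁ ∈ Set.Ico a b,
      ((∑ p ∈ bdry ℓ S F z ρ₁, c p) ≤
        2 / ((1 - α) * (b - a)) * vol c ℓ S F z β ρ₁ *
          Real.log (Real.exp 1 * vol c ℓ S F z β b / vol c ℓ S F z β ρ₁) *
          Real.log (Real.log (Real.exp 1 * vol c ℓ S F z β b / vol c ℓ S F z β a))) ∧
      ((∑ p ∈ bdry ℓ S F z ρ₁, c p) ≤
        2 / ((1 - α) * (b - a)) * cvol c ℓ S F z β ρ₁ *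
          Real.log (Real.exp 1 * cvol c ℓ S F z β a / cvol c ℓ S F z β ρ₁) *
          Real.log (Real.log (Real.exp 1 * cvol c ℓ S F z β a / cvol c ℓ S F z β b))) ∧
      (((bdry ℓ S H z ρ₁).card : ℝ) < (∑ p ∈ H, ℓ p.1 p.2) / (α * (b - a))) := by
  have hba : 0 < b - a := by linarith
  have h1α : 0 < 1 - α := by linarith
  set K := 2 / ((1 - α) * (b - a)) with hK
  have hKpos : 0 < K := by positivity
  set v := vol c ℓ S F z β with hv
  set w := cvol c ℓ S F z β with hw
  have hvpos : ∀ x, 0 < v x := vol_pos S F z hc hℓnn hβ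
  have hwpos : ∀ x, 0 < w x := cvol_pos S F z hc hℓnn hβ
  have hvm : Monotone v := vol_mono S F z hc hℓnn hℓsymm hℓtri β
  have hwm : Antitone w := cvol_anti S F z hc hℓnn hℓsymm hℓtri β
  let g₁ : ℝ → ℝ := fun x => - Real.log (Real.log (Real.exp 1 * v b / v x))
  let g₂ : ℝ → ℝ := fun x => Real.log (Real.log (Real.exp 1 * w a / w x))
  have hg₁ : MonotoneOn g₁ (Set.Icc a b) := fun x hx y hy hxy =>
    neg_le_neg (loglog_le (hvpos x) (hvm hxy) (hvm hy.2))
  have hg₂ : MonotoneOn g₂ (Set.Icc a b) := fun x hx y hy hxy =>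
    loglog_le (hwpos y) (hwm hxy) (hwm hx.1)
  have hs₁ : g₁ b - g₁ a = Real.log (Real.log (Real.exp 1 * v b / v a)) := by
    simp only [g₁]
    rw [mul_div_assoc, div_self (hvpos b).ne']
    simp
  have hs₂ : g₂ b - g₂ a = Real.log (Real.log (Real.exp 1 * w a / w b)) := by
    simp only [g₂]
    rw [mul_div_assoc _ (w a) (w a), div_self (hwpos a).ne']
    simp
  have k₁ := key g₁ a b K hab hKpos hg₁
  have k₂ := key g₂ a b K hab hKpos hg₂
  have k₃ := bad3 ℓ hℓsymm hℓnn hℓtri S H z hH (α * (b - a)) (by positivity)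
  rw [hs₁] at k₁
  rw [hs₂] at k₂
  set A := {x | K * Real.log (Real.log (Real.exp 1 * v b / v a)) < deriv g₁ x}
  set B := {x | K * Real.log (Real.log (Real.exp 1 * w a / w b)) < deriv g₂ x}
  set C := {ρ : ℝ | (∑ p ∈ H, ℓ p.1 p.2) / (α * (b - a)) ≤ ((bdry ℓ S H z ρ).card : ℝ)}
  set μ := MeasureTheory.Measure.restrict MeasureTheory.volume (Set.Ioo a b) with hμ
  have hμC : μ C ≤ ENNReal.ofReal (α * (b - a)) := (MeasureTheory.Measure.restrict_apply_le _ _).trans k₃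
  have hD : μ (Set.range (ℓ z)) = 0 := (Set.finite_range (ℓ z)).measure_zero _
  have hlt : μ (A ∪ B ∪ C ∪ Set.range (ℓ z)) < μ Set.univ := by
    calc μ (A ∪ B ∪ C ∪ Set.range (ℓ z)) ≤ μ A + μ B + μ C + μ (Set.range (ℓ z)) := by
          refine (MeasureTheory.measure_union_le _ _).trans (add_le_add ?_ le_rfl)
          refine (MeasureTheory.measure_union_le _ _).trans (add_le_add ?_ le_rfl)
          exact MeasureTheory.measure_union_le _ _
      _ = μ A + μ B + μ C := by rw [hD, add_zero]
      _ < ENNReal.ofReal (1 / K) + ENNReal.ofReal (1 / K) + ENNReal.ofReal (α * (b - a)) :=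
          ENNReal.add_lt_add_of_lt_of_le (hμC.trans_lt ENNReal.ofReal_lt_top).ne
            (ENNReal.add_lt_add k₁ k₂) hμC
      _ = μ Set.univ := by
          rw [← ENNReal.ofReal_add (by positivity) (by positivity),
            ← ENNReal.ofReal_add (by positivity) (by positivity), hμ,
            MeasureTheory.Measure.restrict_apply_univ, Real.volume_Ioo]
          congr 1
          rw [hK]
          field_simp
          ring
  have hex : ∃ ρ ∈ Set.Ioo a b, ρ ∉ A ∪ B ∪ C ∪ Set.range (ℓ z) := by
    by_contra hcon
    push Not at hcon
    refine hlt.not_ge ?_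
    rw [hμ, MeasureTheory.Measure.restrict_apply_univ, ← MeasureTheory.Measure.restrict_apply_self]
    exact MeasureTheory.measure_mono hcon
  obtain ⟨ρ, hρ, hn⟩ := hex
  simp only [Set.mem_union, not_or] at hn
  obtain ⟨⟨⟨hA, hB⟩, hC⟩, hR⟩ := hn
  have hR' : ∀ x, ℓ z x ≠ ρ := fun x hx => hR ⟨x, hx⟩
  refine ⟨ρ, ⟨hρ.1.le, hρ.2⟩, ?_, ?_, not_le.1 hC⟩
  · have hle : v ρ ≤ v b := hvm hρ.2.le
    have hd := (loglog_deriv (vol_deriv c ℓ S F z β ρ hR') (hvpos ρ) hle).fun_neg.deriv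
    have h : deriv g₁ ρ ≤ _ := not_lt.1 (fun h => hA h)
    have hlog := one_le_log (hvpos ρ) hle
    have hp : 0 < v ρ * Real.log (Real.exp 1 * v b / v ρ) := mul_pos (hvpos ρ) (by linarith)
    rw [show deriv g₁ ρ = _ from hd, neg_div, neg_neg, div_le_iff₀ hp] at h
    calc _ ≤ _ := h
      _ = _ := by ring
  · have hle : w ρ ≤ w a := hwm hρ.1.le
    have hd := (loglog_deriv (cvol_deriv c ℓ S F z β ρ hR') (hwpos ρ) hle).deriv
    have h : deriv g₂ ρ ≤ _ := not_lt.1 (fun h => hB h)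
    have hlog := one_le_log (hwpos ρ) hle
    have hp : 0 < w ρ * Real.log (Real.exp 1 * w a / w ρ) := mul_pos (hwpos ρ) (by linarith)
    rw [show deriv g₂ ρ = _ from hd, neg_neg, div_le_iff₀ hp] at h
    calc _ ≤ _ := h
      _ = _ := by ring

end RegionGrow
end

section
/- Rounding guarantee for 2-route multicut: there is an absolute constant C > 0 such that the following holds. Let G=(V,E) be a finite undirected graph with nonnegative edge costs c_e and source-sink pairs (s_1,t_1),…,(s_r,t_r). Let x : E → [0,∞) and y^1,…,y^r : E → [0,∞) satisfy: for every i and every simple s_i–t_i path P in G, Σ_{e∈P}(x_e + y^i_e) ≥ 1; and Σ_e y^i_e ≤ 1 for every i. Then there exists F ⊆ E with Σ_{e∈F} c_e ≤ C · ln(r+1) · ln ln(e(r+1)) · Σ_e c_e x_e such that for every i there do not exist two s_i–t_i paths in (V, E\F) with disjoint edge sets. In particular, the integrality gap of the natural LP relaxation of 2-route multicut is O(ln r · ln ln r). -/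
namespace TwoRoute

noncomputable def hh (v z : ℝ) : ℝ := v * Real.log v - z * Real.log z - (v - z) * Real.log (v - z)

noncomputable def LL (v : ℝ) : ℝ := Real.log (1 + Real.log v)

noncomputable def HH (v z : ℝ) : ℝ :=
  Real.log (1 + Real.log v - Real.log (v - z)) - Real.log (1 + Real.log v - Real.log z)

lemma key_ineq (v z : ℝ) (hz : 1 ≤ z) (hzv : z ≤ v - z) :
    0 < hh v z ∧ z * (1 + Real.log v - Real.log z) ≤ 5 / 2 * hh v z := by
  have hv : 0 < v := by linarith
  have hz0 : 0 < z := by linarith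
  have hw0 : 0 < v - z := by linarith
  have h1 : Real.log 2 + Real.log z ≤ Real.log v := by
    rw [← Real.log_mul (by norm_num) hz0.ne']
    exact Real.log_le_log (by positivity) (by linarith)
  have h2 : Real.log (v - z) ≤ Real.log v := Real.log_le_log hw0 (by linarith)
  have h3 := Real.log_two_gt_d9
  have h4 : hh v z = z * (Real.log v - Real.log z) + (v - z) * (Real.log v - Real.log (v - z)) := by
    unfold hh; ring
  have h5 : 0 ≤ (v - z) * (Real.log v - Real.log (v - z)) := mul_nonneg hw0.le (by linarith)
  have h6 : z * (2/3) ≤ z * (Real.log v - Real.log z) :=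
    mul_le_mul_of_nonneg_left (by linarith) hz0.le
  constructor
  · nlinarith
  · nlinarith

lemma hh_symm (v z : ℝ) : hh v (v - z) = hh v z := by
  unfold hh; ring_nf

lemma inv_le (v z : ℝ) (hz : 1 ≤ z) (hzv : z ≤ v - 1) :
    0 < hh v z ∧ 1 / hh v z ≤ 5 / 2 * (1 / (z * (1 + Real.log v - Real.log z)) +
      1 / ((v - z) * (1 + Real.log v - Real.log (v - z)))) := by
  have h2 : Real.log (v - z) ≤ Real.log v := Real.log_le_log (by linarith) (by linarith)
  have h3 : Real.log z ≤ Real.log v := Real.log_le_log (by linarith) (by linarith)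
  have hA : 0 < z * (1 + Real.log v - Real.log z) := mul_pos (by linarith) (by linarith)
  have hB : 0 < (v - z) * (1 + Real.log v - Real.log (v - z)) := mul_pos (by linarith) (by linarith)
  have hA' := one_div_pos.2 hA
  have hB' := one_div_pos.2 hB
  have aux : ∀ a h : ℝ, 0 < a → 0 < h → a ≤ 5 / 2 * h → 1 / h ≤ 5 / 2 * (1 / a) := by
    intro a h ha hh hah
    rw [mul_one_div, div_le_div_iff₀ hh ha]; linarith
  rcases le_total z (v - z) with h | h
  · obtain ⟨k1, k2⟩ := key_ineq v z hz h
    refine ⟨k1, ?_⟩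
    have := aux _ _ hA k1 k2
    linarith
  · obtain ⟨k1, k2⟩ := key_ineq v (v - z) (by linarith) (by linarith)
    rw [hh_symm] at k1 k2
    refine ⟨k1, ?_⟩
    have := aux _ _ hB k1 k2
    linarith

lemma HH_deriv (v z : ℝ) (hz : 1 ≤ z) (hzv : z ≤ v - 1) :
    HasDerivAt (HH v) (1 / (z * (1 + Real.log v - Real.log z)) +
      1 / ((v - z) * (1 + Real.log v - Real.log (v - z)))) z := by
  have h2 : Real.log (v - z) ≤ Real.log v := Real.log_le_log (by linarith) (by linarith)
  have h3 : Real.log z ≤ Real.log v := Real.log_le_log (by linarith) (by linarith)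
  have hA : 1 + Real.log v - Real.log z ≠ 0 := by linarith
  have hB : 1 + Real.log v - Real.log (v - z) ≠ 0 := by linarith
  have hz0 : z ≠ 0 := by linarith
  have hw0 : v - z ≠ 0 := by linarith
  have d1 : HasDerivAt (fun z => v - z) (-1) z := by
    simpa using (hasDerivAt_id z).const_sub v
  have d2 := ((d1.log hw0).const_sub (1 + Real.log v)).log hB
  have d3 := (((hasDerivAt_id' z).log hz0).const_sub (1 + Real.log v)).log hA
  have d4 : HasDerivAt (HH v) _ z := d2.sub d3
  refine d4.congr_deriv ?_
  field_simp
  ring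

lemma HH_grow (v p q C : ℝ) (hp : 1 ≤ p) (hpq : p ≤ q) (hq : q ≤ v - 1) 
    (hC : ∀ z, p ≤ z → z ≤ q → C * hh v z ≤ 1) :
    C * (q - p) ≤ 5 / 2 * (HH v q - HH v p) := by
  have := (convex_Icc p q).mul_sub_le_image_sub_of_le_deriv (f := HH v) (C := 2 / 5 * C)
    (fun z hz => (HH_deriv v z (by linarith [hz.1]) (by linarith [hz.2])).continuousAt.continuousWithinAt)
    (fun z hz => by
      rw [interior_Icc] at hz
      exact (HH_deriv v z (by linarith [hz.1]) (by linarith [hz.2])).differentiableAt.differentiableWithinAt)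
    (fun z hz => by
      rw [interior_Icc] at hz
      rw [(HH_deriv v z (by linarith [hz.1]) (by linarith [hz.2])).deriv]
      obtain ⟨h1, h2⟩ := inv_le v z (by linarith [hz.1]) (by linarith [hz.2])
      have h3 : C ≤ 1 / hh v z := by
        rw [le_div_iff₀ h1]; exact hC z hz.1.le hz.2.le
      linarith) p ⟨le_rfl, hpq⟩ q ⟨hpq, le_rfl⟩ hpq
  linarith

lemma HH_bd (v z : ℝ) (hz : 1 ≤ z) (hzv : z ≤ v - 1) : -LL v ≤ HH v z ∧ HH v z ≤ LL v := by
  have h2 : Real.log (v - z) ≤ Real.log v := Real.log_le_log (by linarith) (by linarith)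
  have h3 : Real.log z ≤ Real.log v := Real.log_le_log (by linarith) (by linarith)
  have h4 : 0 ≤ Real.log z := Real.log_nonneg hz
  have h5 : 0 ≤ Real.log (v - z) := Real.log_nonneg (by linarith)
  have a1 : 0 ≤ Real.log (1 + Real.log v - Real.log (v - z)) := Real.log_nonneg (by linarith)
  have a2 : 0 ≤ Real.log (1 + Real.log v - Real.log z) := Real.log_nonneg (by linarith)
  have a3 : Real.log (1 + Real.log v - Real.log (v - z)) ≤ LL v :=
    Real.log_le_log (by linarith) (by linarith)
  have a4 : Real.log (1 + Real.log v - Real.log z) ≤ LL v :=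
    Real.log_le_log (by linarith) (by linarith)
  unfold HH
  constructor <;> linarith

/-- amount of x-volume of an edge swept at radius ρ -/
noncomputable def ue (lo hi x ρ : ℝ) : ℝ :=
  if hi ≤ ρ then x else max 0 (min ρ (min hi (lo + x)) - lo)

noncomputable def ye (lo hi x ρ : ℝ) : ℝ := max 0 (min ρ hi - min hi (lo + x))

lemma ue_nonneg {lo hi x ρ : ℝ} (hx : 0 ≤ x) : 0 ≤ ue lo hi x ρ := by
  unfold ue; split_ifs <;> simp [hx]

lemma ue_le {lo hi x ρ : ℝ} (hx : 0 ≤ x) : ue lo hi x ρ ≤ x := by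
  unfold ue; split_ifs
  · rfl
  · apply max_le hx
    have : min ρ (min hi (lo + x)) ≤ lo + x := (min_le_right _ _).trans (min_le_right _ _)
    linarith

lemma ue_mono {lo hi x a b : ℝ} (hx : 0 ≤ x) (hab : a ≤ b) : ue lo hi x a ≤ ue lo hi x b := by
  by_cases h : hi ≤ b
  · rw [show ue lo hi x b = x by simp [ue, h]]; exact ue_le hx
  · have h' : ¬ hi ≤ a := fun h1 => h (h1.trans hab)
    simp only [ue, h, h', if_false]
    gcongr

lemma ue_cross {lo hi x a b : ℝ} (h1 : lo ≤ a) (hab : a ≤ b)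
    (h2 : b ≤ min hi (lo + x)) (h3 : a < hi) :
    ue lo hi x a + (b - a) ≤ ue lo hi x b ∧ ue lo hi x a + (b - a) ≤ x := by
  have h4 := min_le_left hi (lo + x)
  have h5 := min_le_right hi (lo + x)
  have e : ue lo hi x a = a - lo := by
    simp only [ue, not_le.2 h3, if_false]
    rw [min_eq_left (by linarith), max_eq_right (by linarith)]
  rw [e]
  refine ⟨?_, by linarith⟩
  unfold ue
  split_ifs
  · linarith
  · rw [min_eq_left h2, max_eq_right (by linarith)]; linarith

lemma ye_mono {lo hi x a b : ℝ} (hab : a ≤ b) : ye lo hi x a ≤ ye lo hi x b := by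
  unfold ye; gcongr

lemma ye_nonneg {lo hi x a : ℝ} : 0 ≤ ye lo hi x a := le_max_left _ _

lemma ye_le {lo hi x y a : ℝ} (hy : 0 ≤ y) (h : hi ≤ lo + (x + y)) : ye lo hi x a ≤ y := by
  unfold ye
  apply max_le hy
  have := min_le_right a hi
  rcases min_cases hi (lo + x) with h | h <;> linarith

lemma ye_cross {lo hi x a b : ℝ} (hab : a ≤ b) (h1 : min hi (lo + x) ≤ a) (h2 : b ≤ hi) :
    ye lo hi x a + (b - a) ≤ ye lo hi x b := by
  unfold ye
  rw [min_eq_left h2, min_eq_left (hab.trans h2), max_eq_right (by linarith),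
    max_eq_right (by linarith)]
  linarith

/-- antitone from breakpoint-free intervals -/
lemma sweep_induct (T : Finset ℝ) (Ψ : ℝ → ℝ)
    (h : ∀ a b, 0 ≤ a → a < b → b ≤ 1 → (∀ τ ∈ T, τ ≤ a ∨ b ≤ τ) → Ψ b ≤ Ψ a) :
    ∀ (n : ℕ) (a b : ℝ), 0 ≤ a → a < b → b ≤ 1 → (T.filter (fun τ => a < τ ∧ τ < b)).card = n →
      Ψ b ≤ Ψ a := by
  intro n
  induction n using Nat.strong_induction_on with
  | _ n ih =>
    intro a b ha hab hb hn
    by_cases hex : ∃ τ ∈ T, a < τ ∧ τ < b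
    · obtain ⟨τ, hτ, h1, h2⟩ := hex
      have c1 : (T.filter (fun σ => a < σ ∧ σ < τ)).card < n := by
        rw [← hn]
        apply Finset.card_lt_card
        refine ⟨fun σ hσ => ?_, fun hs => ?_⟩
        · simp only [Finset.mem_filter] at hσ ⊢
          exact ⟨hσ.1, hσ.2.1, hσ.2.2.trans h2⟩
        · have := hs (Finset.mem_filter.2 ⟨hτ, h1, h2⟩)
          simp at this
      have c2 : (T.filter (fun σ => τ < σ ∧ σ < b)).card < n := by
        rw [← hn]
        apply Finset.card_lt_card
        refine ⟨fun σ hσ => ?_, fun hs => ?_⟩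
        · simp only [Finset.mem_filter] at hσ ⊢
          exact ⟨hσ.1, h1.trans hσ.2.1, hσ.2.2⟩
        · have := hs (Finset.mem_filter.2 ⟨hτ, h1, h2⟩)
          simp at this
      exact (ih _ c2 τ b (by linarith) h2 hb rfl).trans (ih _ c1 a τ ha h1 (by linarith) rfl)
    · push Not at hex
      exact h a b ha hab hb (fun τ hτ => by
        by_cases h1 : a < τ
        · exact Or.inr (hex τ hτ h1)
        · exact Or.inl (not_lt.1 h1))

lemma sweep {ε τ : Type*} (E : Finset ε) (T : Finset τ) (lo hi x y c : ε → ℝ) (d : τ → ℝ)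
    (v M : ℝ) (hx : ∀ e ∈ E, 0 ≤ x e) (hy : ∀ e ∈ E, 0 ≤ y e) (hc : ∀ e ∈ E, 0 ≤ c e)
    (hlh : ∀ e ∈ E, lo e ≤ hi e) (hh1 : ∀ e ∈ E, hi e ≤ lo e + (x e + y e))
    (hysum : ∑ e ∈ E, y e ≤ 1) (τ0 τ1 : τ) (hτ0 : τ0 ∈ T) (hτ1 : τ1 ∈ T) (hd0 : d τ0 ≤ 0)
    (hd1 : 1 ≤ d τ1) (hv : v = T.card + ∑ e ∈ E, c e * x e) (hM : 10 * LL v < M) :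
    ∃ a z : ℝ, 0 ≤ a ∧ a < 1 ∧
      (E.filter (fun e => lo e ≤ a ∧ a < hi e ∧ min (hi e) (lo e + x e) ≤ a)).card ≤ 1 ∧
      ∑ e ∈ E.filter (fun e => lo e ≤ a ∧ a < min (hi e) (lo e + x e)), c e ≤ M * hh v z ∧
      (T.filter (fun τ => d τ ≤ a)).card + ∑ e ∈ E.filter (fun e => hi e ≤ a), c e * x e ≤ z ∧
      (T.filter (fun τ => a < d τ)).card + ∑ e ∈ E.filter (fun e => a < lo e), c e * x e ≤ v - z := by
  classical
  by_contra hcon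
  push Not at hcon
  set N : ℝ → ℝ := fun ρ => ((T.filter (fun τ => d τ ≤ ρ ∧ d τ < 1)).card : ℝ) with hN
  set u : ℝ → ℝ := fun ρ => N ρ + ∑ e ∈ E, c e * ue (lo e) (hi e) (x e) ρ with hu
  set Y : ℝ → ℝ := fun ρ => ∑ e ∈ E, ye (lo e) (hi e) (x e) ρ with hY
  have Nmono : ∀ a b, a ≤ b → N a ≤ N b := by
    intro a b hab
    simp only [hN, Nat.cast_le]
    apply Finset.card_le_card
    intro t ht
    simp only [Finset.mem_filter] at ht ⊢
    exact ⟨ht.1, ht.2.1.trans hab, ht.2.2⟩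
  have Npos : ∀ a, 0 ≤ a → 1 ≤ N a := by
    intro a ha
    simp only [hN, Nat.one_le_cast, Nat.one_le_iff_ne_zero, ← Nat.pos_iff_ne_zero]
    exact Finset.card_pos.2 ⟨τ0, by simp only [Finset.mem_filter]; exact ⟨hτ0, by linarith, by linarith⟩⟩
  have Nle : ∀ a, N a ≤ T.card - 1 := by
    intro a
    have : (T.filter (fun τ => d τ ≤ a ∧ d τ < 1)).card < T.card := by
      apply Finset.card_lt_card
      refine ⟨Finset.filter_subset _ _, fun hs => ?_⟩
      have := hs hτ1
      simp only [Finset.mem_filter] at this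
      linarith [this.2.2]
    have h2 : ((T.filter (fun τ => d τ ≤ a ∧ d τ < 1)).card : ℝ) + 1 ≤ T.card := by exact_mod_cast this
    simp only [hN]; linarith
  have umono : ∀ a b, a ≤ b → u a ≤ u b := by
    intro a b hab
    apply add_le_add (Nmono a b hab)
    apply Finset.sum_le_sum
    intro e he
    exact mul_le_mul_of_nonneg_left (ue_mono (hx e he) hab) (hc e he)
  have u1 : ∀ a, 0 ≤ a → 1 ≤ u a := by
    intro a ha
    have : 0 ≤ ∑ e ∈ E, c e * ue (lo e) (hi e) (x e) a :=
      Finset.sum_nonneg fun e he => mul_nonneg (hc e he) (ue_nonneg (hx e he))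
    simp only [hu]; linarith [Npos a ha]
  have u2 : ∀ a, u a ≤ v - 1 := by
    intro a
    have : ∑ e ∈ E, c e * ue (lo e) (hi e) (x e) a ≤ ∑ e ∈ E, c e * x e :=
      Finset.sum_le_sum fun e he => mul_le_mul_of_nonneg_left (ue_le (hx e he)) (hc e he)
    simp only [hu]; linarith [Nle a]
  have hv2 : 2 ≤ v := by linarith [u1 0 le_rfl, u2 0]
  have hLL : 0 ≤ LL v := Real.log_nonneg (by linarith [Real.log_nonneg (show (1:ℝ) ≤ v by linarith)])
  have hM0 : 0 < M := by linarith
  have Hmono : ∀ p q, 1 ≤ p → p ≤ q → q ≤ v - 1 → HH v p ≤ HH v q := by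
    intro p q h1 h2 h3
    have := HH_grow v p q 0 h1 h2 h3 (by simp)
    linarith
  have key := sweep_induct (E.image hi ∪ E.image lo ∪ E.image (fun e => min (hi e) (lo e + x e)))
    (fun ρ => M * (ρ - Y ρ / 2) - 5 / 2 * HH v (u ρ)) ?_ _ 0 1 le_rfl one_pos le_rfl rfl
  · have b1 := HH_bd v (u 1) (u1 1 zero_le_one) (u2 1)
    have b0 := HH_bd v (u 0) (u1 0 le_rfl) (u2 0)
    have hY0 : 0 ≤ Y 0 := Finset.sum_nonneg fun e he => ye_nonneg
    have hY1 : Y 1 ≤ 1 := le_trans (Finset.sum_le_sum fun e he => ye_le (hy e he) (hh1 e he)) hysum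
    nlinarith [mul_nonneg hM0.le hY0, mul_le_mul_of_nonneg_left hY1 hM0.le]
  · intro a b ha hab hb hT
    have hThi : ∀ e ∈ E, hi e ≤ a ∨ b ≤ hi e := fun e he => hT _ (by
      simp only [Finset.mem_union, Finset.mem_image]; exact Or.inl (Or.inl ⟨e, he, rfl⟩))
    have hTmid : ∀ e ∈ E, min (hi e) (lo e + x e) ≤ a ∨ b ≤ min (hi e) (lo e + x e) :=
      fun e he => hT _ (by
        simp only [Finset.mem_union, Finset.mem_image]; exact (Or.inr ⟨e, he, rfl⟩))
    set X := E.filter (fun e => lo e ≤ a ∧ a < min (hi e) (lo e + x e)) with hX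
    set Yc := E.filter (fun e => lo e ≤ a ∧ a < hi e ∧ min (hi e) (lo e + x e) ≤ a) with hYc
    have hYmono : Y a ≤ Y b := Finset.sum_le_sum fun e he => ye_mono hab.le
    by_cases hcard : Yc.card ≤ 1
    · -- good
      set q := u a + (b - a) * ∑ e ∈ X, c e with hq
      have hXs : ∑ e ∈ X, c e = ∑ e ∈ E, if e ∈ X then c e else 0 := by
        rw [Finset.sum_ite_mem, Finset.inter_eq_right.2 (Finset.filter_subset _ _)]
      have hXc : ∀ e ∈ X, ue (lo e) (hi e) (x e) a + (b - a) ≤ ue (lo e) (hi e) (x e) b ∧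
          ue (lo e) (hi e) (x e) a + (b - a) ≤ x e := by
        intro e he
        rw [hX, Finset.mem_filter] at he
        apply ue_cross he.2.1 hab.le
        · rcases hTmid e he.1 with h | h
          · linarith [he.2.2]
          · exact h
        · exact lt_of_lt_of_le he.2.2 (min_le_left _ _)
      have hqb : q ≤ u b := by
        have : ∑ e ∈ E, c e * ue (lo e) (hi e) (x e) a + (b - a) * ∑ e ∈ X, c e ≤
            ∑ e ∈ E, c e * ue (lo e) (hi e) (x e) b := by
          rw [hXs, Finset.mul_sum, ← Finset.sum_add_distrib]
          apply Finset.sum_le_sum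
          intro e he
          split_ifs with hex
          · nlinarith [mul_le_mul_of_nonneg_left (hXc e hex).1 (hc e he)]
          · linarith [mul_le_mul_of_nonneg_left (ue_mono (lo := lo e) (hi := hi e) (hx e he) hab.le) (hc e he)]
        simp only [hq, hu]; linarith [Nmono a b hab.le]
      have hc0 : 0 ≤ ∑ e ∈ X, c e :=
        Finset.sum_nonneg fun e he => hc e (Finset.filter_subset _ _ he)
      have haq : u a ≤ q := by
        rw [hq]; nlinarith
      have h1 : ((T.filter (fun τ => d τ ≤ a)).card : ℝ) + ∑ e ∈ E.filter (fun e => hi e ≤ a), c e * x e ≤ u a := by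
        apply add_le_add
        · simp only [hN, Nat.cast_le]
          apply Finset.card_le_card
          intro t ht
          simp only [Finset.mem_filter] at ht ⊢
          exact ⟨ht.1, ht.2, by linarith⟩
        · rw [Finset.sum_filter]
          apply Finset.sum_le_sum
          intro e he
          split_ifs with h
          · simp [ue, h]
          · exact mul_nonneg (hc e he) (ue_nonneg (hx e he))
      have h2 : ((T.filter (fun τ => a < d τ)).card : ℝ) + ∑ e ∈ E.filter (fun e => a < lo e), c e * x e ≤ v - q := by
        have k1 : ((T.filter (fun τ => a < d τ)).card : ℝ) + N a ≤ T.card := by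
          have e1 := Finset.card_filter_add_card_filter_not (s := T) (fun τ => a < d τ)
          have e2 : (T.filter (fun τ => d τ ≤ a ∧ d τ < 1)).card ≤ (T.filter (fun τ => ¬ a < d τ)).card := by
            apply Finset.card_le_card
            intro t ht
            simp only [Finset.mem_filter] at ht ⊢
            exact ⟨ht.1, not_lt.2 ht.2.1⟩
          simp only [hN]
          exact_mod_cast (by omega : (T.filter (fun τ => a < d τ)).card + (T.filter (fun τ => d τ ≤ a ∧ d τ < 1)).card ≤ T.card)
        have k2 : ∑ e ∈ E.filter (fun e => a < lo e), c e * x e +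
            (∑ e ∈ E, c e * ue (lo e) (hi e) (x e) a + (b - a) * ∑ e ∈ X, c e) ≤ ∑ e ∈ E, c e * x e := by
          rw [hXs, Finset.mul_sum, ← Finset.sum_add_distrib, Finset.sum_filter, ← Finset.sum_add_distrib]
          apply Finset.sum_le_sum
          intro e he
          by_cases hex : e ∈ X
          · have : ¬ a < lo e := not_lt.2 (by rw [hX, Finset.mem_filter] at hex; exact hex.2.1)
            rw [if_pos hex, if_neg this]
            nlinarith [mul_le_mul_of_nonneg_left (hXc e hex).2 (hc e he)]
          · rw [if_neg hex]
            by_cases hl : a < lo e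
            · rw [if_pos hl]
              by_cases hhi : hi e ≤ a
              · exfalso; linarith [hlh e he]
              · have : ue (lo e) (hi e) (x e) a = 0 := by
                  simp only [ue, hhi, if_false]
                  apply max_eq_left
                  linarith [min_le_left a (min (hi e) (lo e + x e))]
                rw [this]; linarith
            · rw [if_neg hl]
              linarith [mul_le_mul_of_nonneg_left (ue_le (lo := lo e) (hi := hi e) (ρ := a) (hx e he)) (hc e he)]
        simp only [hq, hu, hv]; linarith
      have hbad : ∀ z, u a ≤ z → z ≤ q → M * hh v z < ∑ e ∈ X, c e := by
        intro z hz1 hz2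
        by_contra hlt
        have := hcon a z ha (by linarith) hcard (not_lt.1 hlt) (by linarith)
        linarith
      have hcpos : 0 < ∑ e ∈ X, c e := by
        have := hbad (u a) le_rfl haq
        have h3 := (inv_le v (u a) (u1 a ha) (u2 a)).1
        nlinarith [mul_pos hM0 h3]
      have hg := HH_grow v (u a) q (M / ∑ e ∈ X, c e) (u1 a ha) haq (hqb.trans (u2 b)) (by
        intro z hz1 hz2
        rw [div_mul_eq_mul_div, div_le_one hcpos]
        exact (hbad z hz1 hz2).le)
      have hg2 : M / (∑ e ∈ X, c e) * (q - u a) = M * (b - a) := by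
        rw [hq]; field_simp; ring
      have hg3 := Hmono q (u b) (by linarith [u1 a ha]) hqb (u2 b)
      nlinarith [mul_le_mul_of_nonneg_left hYmono hM0.le]
    · -- bad
      have hcard' : (2:ℝ) ≤ Yc.card := by exact_mod_cast (by omega : 2 ≤ Yc.card)
      have : Y a + (b - a) * Yc.card ≤ Y b := by
        have : ((b - a) * Yc.card : ℝ) = ∑ e ∈ E, if e ∈ Yc then (b - a) else 0 := by
          rw [Finset.sum_ite_mem, Finset.inter_eq_right.2 (Finset.filter_subset _ _)]
          rw [Finset.sum_const, nsmul_eq_mul, mul_comm]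
        rw [this]
        simp only [hY]
        rw [← Finset.sum_add_distrib]
        apply Finset.sum_le_sum
        intro e he
        split_ifs with hex
        · rw [hYc, Finset.mem_filter] at hex
          apply ye_cross hab.le hex.2.2.2
          rcases hThi e he with h | h
          · linarith [hex.2.2.1]
          · exact h
        · linarith [ye_mono (lo := lo e) (hi := hi e) (x := x e) hab.le]
      have h3 : (b - a) * 2 ≤ Y b - Y a := by nlinarith
      have hg3 := Hmono (u a) (u b) (u1 a ha) (umono a b hab.le) (u2 b)
      nlinarith [mul_le_mul_of_nonneg_left h3 hM0.le]

section graph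
open Classical

variable {V : Type} [Fintype V] {G : SimpleGraph V}

lemma walk_len_ge (ℓ : Sym2 V → ℝ) (hℓ : ∀ e, 0 ≤ ℓ e) {a b : V}
    (h : ∀ p : G.Walk a b, p.IsPath → 1 ≤ (p.edges.map ℓ).sum) (p : G.Walk a b) :
    1 ≤ (p.edges.map ℓ).sum := by
  refine (h p.bypass p.bypass_isPath).trans ?_
  apply List.Sublist.sum_le_sum (p.edges_bypass_sublist_edges.map ℓ)
  intro z hz
  obtain ⟨e, -, rfl⟩ := List.mem_map.1 hz
  exact hℓ e

lemma exists_pot (G : SimpleGraph V) (S : Finset V) (ℓ : Sym2 V → ℝ) (hℓ : ∀ e, 0 ≤ ℓ e) (a b : V)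
    (ha : a ∈ S)
    (h : ∀ p : G.Walk a b, p.IsPath → 1 ≤ (p.edges.map ℓ).sum) :
    ∃ d : V → ℝ, d a ≤ 0 ∧ 1 ≤ d b ∧ ∀ u v, G.Adj u v → u ∈ S → v ∈ S → d v ≤ d u + ℓ s(u, v) := by
  let A : V → Set ℝ := fun w => {z | z = 1 ∨ ∃ p : G.Walk w a, (∀ q ∈ p.support, q ∈ S) ∧
    z = (p.edges.map ℓ).sum}
  have hnn : ∀ w, ∀ z ∈ A w, 0 ≤ z := by
    rintro w z (rfl | ⟨p, -, rfl⟩)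
    · norm_num
    · apply List.sum_nonneg
      intro z hz
      obtain ⟨e, -, rfl⟩ := List.mem_map.1 hz
      exact hℓ e
  have hbdd : ∀ w, BddBelow (A w) := fun w => ⟨0, fun z hz => hnn w z hz⟩
  have hne : ∀ w, (A w).Nonempty := fun w => ⟨1, Or.inl rfl⟩
  refine ⟨fun w => sInf (A w), ?_, ?_, ?_⟩
  · apply csInf_le (hbdd a)
    right
    exact ⟨SimpleGraph.Walk.nil, by simpa using ha, by simp⟩
  · apply le_csInf (hne b)
    rintro z (rfl | ⟨p, -, rfl⟩)
    · exact le_rfl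
    · have := walk_len_ge ℓ hℓ h p.reverse
      simpa [SimpleGraph.Walk.edges_reverse, List.sum_reverse] using this
  · intro u v huv hu hv
    rw [← sub_le_iff_le_add]
    apply le_csInf (hne u)
    rintro z (rfl | ⟨p, hp, rfl⟩)
    · have : sInf (A v) ≤ 1 := csInf_le (hbdd v) (Or.inl rfl)
      linarith [hℓ s(u, v)]
    · rw [sub_le_iff_le_add]
      apply csInf_le (hbdd v)
      right
      refine ⟨SimpleGraph.Walk.cons huv.symm p, ?_, ?_⟩
      · intro q hq
        rw [SimpleGraph.Walk.support_cons, List.mem_cons] at hq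
        rcases hq with rfl | hq
        · exact hv
        · exact hp q hq
      · rw [SimpleGraph.Walk.edges_cons, List.map_cons, List.sum_cons, Sym2.eq_swap]; ring

noncomputable def ES (G : SimpleGraph V) (S : Finset V) : Finset (Sym2 V) :=
  G.edgeFinset.filter (fun e => ∀ w ∈ e, w ∈ S)

noncomputable def TS {r : ℕ} (s t : Fin r → V) (S : Finset V) : Finset (Fin r ⊕ Fin r) :=
  Finset.univ.filter (fun τ => Sum.elim s t τ ∈ S)

noncomputable def vol {r : ℕ} (G : SimpleGraph V) (c x : Sym2 V → ℝ) (s t : Fin r → V)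
    (S : Finset V) : ℝ := (TS s t S).card + ∑ e ∈ ES G S, c e * x e

/-- separation within `S` -/
def Sep {r : ℕ} (G : SimpleGraph V) (s t : Fin r → V) (S : Finset V) (F : Finset (Sym2 V)) : Prop :=
  ∀ i, ∀ p q : G.Walk (s i) (t i), p.IsPath → q.IsPath → (∀ w ∈ p.support, w ∈ S) →
    (∀ w ∈ q.support, w ∈ S) → (∀ e ∈ p.edges, e ∉ F) → (∀ e ∈ q.edges, e ∉ F) →
    ∃ e ∈ p.edges, e ∈ q.edges

/-- A walk crossing the boundary of `B`, one way or the other -/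
lemma exists_cross (B : Finset V) {a b : V} (p : G.Walk a b) (h : ¬ (a ∈ B ↔ b ∈ B)) :
    ∃ u v, s(u, v) ∈ p.edges ∧ u ∈ p.support ∧ v ∈ p.support ∧ G.Adj u v ∧ u ∈ B ∧ v ∉ B := by
  by_cases ha : a ∈ B
  · have hb : b ∉ B := fun hb => h (by tauto)
    obtain ⟨d, hd, h1, h2⟩ := p.exists_boundary_dart (B : Set V) ha hb
    exact ⟨d.fst, d.snd, List.mem_map.2 ⟨d, hd, rfl⟩, p.dart_fst_mem_support_of_mem_darts hd,
      p.dart_snd_mem_support_of_mem_darts hd, d.adj, h1, h2⟩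
  · have hb : b ∈ B := by by_contra hb; exact h (by tauto)
    obtain ⟨d, hd, h1, h2⟩ := p.exists_boundary_dart ((B : Set V)ᶜ) ha (by simpa using hb)
    refine ⟨d.snd, d.fst, ?_, p.dart_snd_mem_support_of_mem_darts hd,
      p.dart_fst_mem_support_of_mem_darts hd, d.adj.symm, by simpa using h2, h1⟩
    rw [Sym2.eq_swap]
    exact List.mem_map.2 ⟨d, hd, rfl⟩

lemma path_stays (S B : Finset V) (K : Finset (Sym2 V)) {a b : V} (p : G.Walk a b)
    (hp : p.IsPath) (hS : ∀ w ∈ p.support, w ∈ S) (hK : K.card ≤ 1)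
    (hc : ∀ u v, s(u, v) ∈ p.edges → G.Adj u v → u ∈ S → v ∈ S → u ∈ B → v ∉ B → s(u, v) ∈ K)
    (hab : a ∈ B ↔ b ∈ B) : ∀ w ∈ p.support, (w ∈ B ↔ a ∈ B) := by
  intro w hw
  by_contra hne
  have hpe := p.take_spec hw
  have hnd := hp.isTrail.edges_nodup
  rw [← hpe, SimpleGraph.Walk.edges_append] at hnd
  obtain ⟨u, v, he, hu, hv, had, hB, hB'⟩ := exists_cross B (p.takeUntil w hw) (by tauto)
  obtain ⟨u2, v2, he2, hu2, hv2, had2, hB2, hB2'⟩ := exists_cross B (p.dropUntil w hw) (by tauto)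
  have k1 := hc u v (p.edges_takeUntil_subset hw he) had (hS _ (p.support_takeUntil_subset hw hu))
    (hS _ (p.support_takeUntil_subset hw hv)) hB hB'
  have k2 := hc u2 v2 (p.edges_dropUntil_subset hw he2) had2 (hS _ (p.support_dropUntil_subset hw hu2))
    (hS _ (p.support_dropUntil_subset hw hv2)) hB2 hB2'
  have := Finset.card_le_one.1 hK _ k1 _ k2
  rw [← this] at he2
  exact (List.nodup_append.1 hnd).2.2 _ he _ he2 rfl

lemma vol_mono {r : ℕ} (c x : Sym2 V → ℝ) (s t : Fin r → V) (hc : ∀ e, 0 ≤ c e) (hx : ∀ e, 0 ≤ x e)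
    {S S' : Finset V} (h : S ⊆ S') : vol G c x s t S ≤ vol G c x s t S' := by
  unfold vol
  apply add_le_add
  · norm_cast
    apply Finset.card_le_card
    intro τ hτ
    simp only [TS, Finset.mem_filter] at hτ ⊢
    exact ⟨hτ.1, h hτ.2⟩
  · apply Finset.sum_le_sum_of_subset_of_nonneg
    · intro e he
      simp only [ES, Finset.mem_filter] at he ⊢
      exact ⟨he.1, fun w hw => h (he.2 w hw)⟩
    · intro e _ _
      exact mul_nonneg (hc e) (hx e)

lemma vol_ge_one {r : ℕ} (c x : Sym2 V → ℝ) (s t : Fin r → V) (hc : ∀ e, 0 ≤ c e) (hx : ∀ e, 0 ≤ x e)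
    {S : Finset V} (τ : Fin r ⊕ Fin r) (h : Sum.elim s t τ ∈ S) : 1 ≤ vol G c x s t S := by
  have h1 : 0 ≤ ∑ e ∈ ES G S, c e * x e := Finset.sum_nonneg fun e _ => mul_nonneg (hc e) (hx e)
  have h2 : 0 < (TS s t S).card := Finset.card_pos.2 ⟨τ, by simp [TS, h]⟩
  have h3 : (1:ℝ) ≤ (TS s t S).card := by exact_mod_cast h2
  unfold vol; linarith

lemma rec_step {r : ℕ} (c : Sym2 V → ℝ) (s t : Fin r → V) (x : Sym2 V → ℝ) (y : Fin r → Sym2 V → ℝ)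
    (hc : ∀ e, 0 ≤ c e) (hx : ∀ e, 0 ≤ x e) (hy : ∀ i e, 0 ≤ y i e)
    (hpath : ∀ i (p : G.Walk (s i) (t i)), p.IsPath →
        1 ≤ (p.edges.map (fun e => x e + y i e)).sum)
    (hysum : ∀ i, ∑ e ∈ G.edgeFinset, y i e ≤ 1) (M : ℝ)
    (S : Finset V) (hM : 10 * LL (vol G c x s t S) < M) (i : Fin r) (hs : s i ∈ S) (ht : t i ∈ S) :
    ∃ (B : Finset V) (X K : Finset (Sym2 V)) (z : ℝ), B ⊆ S ∧ s i ∈ B ∧ t i ∉ B ∧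
      X ⊆ G.edgeFinset ∧ K.card ≤ 1 ∧
      (∀ u v, s(u, v) ∉ X → G.Adj u v → u ∈ S → v ∈ S → u ∈ B → v ∉ B → s(u, v) ∈ K) ∧
      ∑ e ∈ X, c e ≤ M * hh (vol G c x s t S) z ∧
      vol G c x s t B ≤ z ∧ vol G c x s t (S \ B) ≤ vol G c x s t S - z := by
  obtain ⟨d, hda, hdb, hdl⟩ := exists_pot G S (fun e => x e + y i e)
    (fun e => add_nonneg (hx e) (hy i e)) (s i) (t i) hs (hpath i)
  obtain ⟨a, z, ha0, ha1, hK, hX, hz1, hz2⟩ := sweep (ES G S) (TS s t S)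
    (fun e => (e.map d).inf) (fun e => (e.map d).sup) x (y i) c (fun τ => d (Sum.elim s t τ))
    (vol G c x s t S) M (fun e _ => hx e) (fun e _ => hy i e) (fun e _ => hc e)
    (fun e _ => Sym2.inf_le_sup _) (by
      intro e he
      induction e using Sym2.ind with
      | _ u v =>
        simp only [ES, Finset.mem_filter, SimpleGraph.mem_edgeFinset, SimpleGraph.mem_edgeSet] at he
        have hu := he.2 u (by simp)
        have hv := he.2 v (by simp)
        have h1 := hdl u v he.1 hu hv
        have h2 := hdl v u he.1.symm hv hu
        rw [Sym2.eq_swap] at h2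
        simp only [Sym2.map_mk, Sym2.inf_mk, Sym2.sup_mk]
        have h3 := hx s(u, v)
        have h4 := hy i s(u, v)
        rcases le_total (d u) (d v) with h | h
        · rw [sup_eq_right.2 h, inf_eq_left.2 h]; exact h1
        · rw [sup_eq_left.2 h, inf_eq_right.2 h]; exact h2)
    ((Finset.sum_le_sum_of_subset_of_nonneg (Finset.filter_subset _ _) (fun e _ _ => hy i e)).trans
      (hysum i)) (Sum.inl i) (Sum.inr i) (by simp [TS, hs]) (by simp [TS, ht]) hda hdb rfl hM
  refine ⟨S.filter (fun w => d w ≤ a), _, _, z, Finset.filter_subset _ _, ?_, ?_, ?_, hK, ?_, hX, ?_, ?_⟩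
  · simp only [Finset.mem_filter]; exact ⟨hs, by linarith⟩
  · simp only [Finset.mem_filter, not_and, not_le]; intro _; linarith
  · exact (Finset.filter_subset _ _).trans (Finset.filter_subset _ _)
  · intro u v hnX hadj hu hv huB hvB
    simp only [Finset.mem_filter, not_and, not_le] at huB hvB
    have hduv : d u ≤ d v := huB.2.trans (hvB hv).le
    have hE : s(u, v) ∈ ES G S := by
      simp only [ES, Finset.mem_filter, SimpleGraph.mem_edgeFinset, SimpleGraph.mem_edgeSet]
      refine ⟨hadj, fun w hw => ?_⟩
      rcases Sym2.mem_iff.1 hw with rfl | rfl <;> assumption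
    simp only [Finset.mem_filter, Sym2.map_mk, Sym2.inf_mk, Sym2.sup_mk, sup_eq_right.2 hduv,
      inf_eq_left.2 hduv, hE, true_and, huB.2, hvB hv, not_lt] at hnX ⊢
    exact hnX
  · refine le_trans ?_ hz1
    unfold vol
    apply add_le_add
    · norm_cast
      apply Finset.card_le_card
      intro τ hτ
      simp only [TS, Finset.mem_filter] at hτ ⊢
      tauto
    · apply Finset.sum_le_sum_of_subset_of_nonneg
      · intro e he
        induction e using Sym2.ind with
        | _ u v =>
          simp only [ES, Finset.mem_filter] at he ⊢
          have hu := he.2 u (by simp)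
          have hv := he.2 v (by simp)
          refine ⟨⟨he.1, fun w hw => (he.2 w hw).1⟩, ?_⟩
          simpa using ⟨hu.2, hv.2⟩
      · intro e _ _
        exact mul_nonneg (hc e) (hx e)
  · refine le_trans ?_ hz2
    unfold vol
    apply add_le_add
    · norm_cast
      apply Finset.card_le_card
      intro τ hτ
      simp only [TS, Finset.mem_filter, Finset.mem_sdiff, not_and, not_le] at hτ ⊢
      exact ⟨⟨hτ.1, hτ.2.1⟩, hτ.2.2 hτ.2.1⟩
    · apply Finset.sum_le_sum_of_subset_of_nonneg
      · intro e he
        induction e using Sym2.ind with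
        | _ u v =>
          simp only [ES, Finset.mem_filter, Finset.mem_sdiff, not_and, not_le] at he ⊢
          have hu := he.2 u (by simp)
          have hv := he.2 v (by simp)
          refine ⟨⟨he.1, fun w hw => (he.2 w hw).1⟩, ?_⟩
          simpa using ⟨hu.2 hu.1, hv.2 hv.1⟩
      · intro e _ _
        exact mul_nonneg (hc e) (hx e)

lemma LL_mono {a b : ℝ} (h1 : 1 ≤ a) (h : a ≤ b) : LL a ≤ LL b := by
  have := Real.log_nonneg h1
  exact Real.log_le_log (by linarith) (by linarith [Real.log_le_log (by linarith) h])

lemma recursion {r : ℕ} (c : Sym2 V → ℝ) (s t : Fin r → V) (x : Sym2 V → ℝ) (y : Fin r → Sym2 V → ℝ)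
    (hc : ∀ e, 0 ≤ c e) (hx : ∀ e, 0 ≤ x e) (hy : ∀ i e, 0 ≤ y i e)
    (hpath : ∀ i (p : G.Walk (s i) (t i)), p.IsPath →
        1 ≤ (p.edges.map (fun e => x e + y i e)).sum)
    (hysum : ∀ i, ∑ e ∈ G.edgeFinset, y i e ≤ 1) (M : ℝ) (hM0 : 0 < M) (v0 : ℝ)
    (hv0 : vol G c x s t Finset.univ ≤ v0)
    (hM : 10 * LL v0 < M) :
    ∀ (n : ℕ) (S : Finset V), S.card = n → ∀ z, 1 ≤ z → vol G c x s t S ≤ z →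
      ∃ F : Finset (Sym2 V), F ⊆ G.edgeFinset ∧ ∑ e ∈ F, c e ≤ M * (z * Real.log z) ∧
        Sep G s t S F := by
  intro n
  induction n using Nat.strong_induction_on with
  | _ n ih =>
    intro S hn Z hZ hSZ
    by_cases hex : ∃ i, s i ∈ S ∧ t i ∈ S
    swap
    · refine ⟨∅, by simp, ?_, ?_⟩
      · have := Real.log_nonneg hZ
        simp only [Finset.sum_empty]; positivity
      · intro i p q _ _ hp _ _ _
        exact absurd ⟨i, hp _ p.start_mem_support, hp _ p.end_mem_support⟩ hex
    · obtain ⟨i, hs, ht⟩ := hex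
      have hv1 : 1 ≤ vol G c x s t S := vol_ge_one c x s t hc hx (Sum.inl i) hs
      obtain ⟨B, X, K, z, hBS, hsB, htB, hXE, hK, hcr, hXc, hz1, hz2⟩ :=
        rec_step c s t x y hc hx hy hpath hysum M S
          (lt_of_le_of_lt (by
            have := LL_mono hv1 ((vol_mono c x s t hc hx (Finset.subset_univ S)).trans hv0)
            linarith) hM) i hs ht
      have hB1 : 1 ≤ vol G c x s t B := vol_ge_one c x s t hc hx (Sum.inl i) hsB
      have hC1 : 1 ≤ vol G c x s t (S \ B) := vol_ge_one c x s t hc hx (Sum.inr i) (by simp [ht, htB])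
      obtain ⟨F1, hF1, hF1c, hF1s⟩ := ih B.card (by
        rw [← hn]; exact Finset.card_lt_card ⟨hBS, fun h => htB (h ht)⟩) B rfl z (by linarith) hz1
      obtain ⟨F2, hF2, hF2c, hF2s⟩ := ih (S \ B).card (by
        rw [← hn]; exact Finset.card_lt_card ⟨Finset.sdiff_subset, fun h => by
          have := h hs; simp [hsB] at this⟩) (S \ B) rfl _ (by linarith) hz2
      refine ⟨X ∪ (F1 ∪ F2), Finset.union_subset hXE (Finset.union_subset hF1 hF2), ?_, ?_⟩
      · have hun : ∀ A D : Finset (Sym2 V), ∑ e ∈ A ∪ D, c e ≤ ∑ e ∈ A, c e + ∑ e ∈ D, c e := by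
          intro A D
          rw [← Finset.sum_union_inter]
          linarith [Finset.sum_nonneg (s := A ∩ D) (f := c) fun e _ => hc e]
        have h1 := hun X (F1 ∪ F2)
        have h2 := hun F1 F2
        have h3 : vol G c x s t S * Real.log (vol G c x s t S) ≤ Z * Real.log Z := by
          apply mul_le_mul hSZ (Real.log_le_log (by linarith) hSZ) (Real.log_nonneg hv1) (by linarith)
        have h4 := mul_le_mul_of_nonneg_left h3 hM0.le
        unfold hh at hXc
        nlinarith
      · intro j p q hp hq hpS hqS hpF hqF
        have hcp : ∀ {a b : V} (p : G.Walk a b), (∀ e ∈ p.edges, e ∉ X ∪ (F1 ∪ F2)) →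
            ∀ u v, s(u, v) ∈ p.edges → G.Adj u v → u ∈ S → v ∈ S → u ∈ B → v ∉ B → s(u, v) ∈ K := by
          intro a b p hpF u v he
          exact hcr u v (fun h => hpF _ he (Finset.mem_union_left _ h))
        by_cases hj : s j ∈ B ↔ t j ∈ B
        · have p1 := path_stays S B K p hp hpS hK (hcp p hpF) hj
          have q1 := path_stays S B K q hq hqS hK (hcp q hqF) hj
          by_cases hsj : s j ∈ B
          · exact hF1s j p q hp hq (fun w hw => (p1 w hw).2 hsj) (fun w hw => (q1 w hw).2 hsj)
              (fun e he h => hpF e he (by simp [h])) (fun e he h => hqF e he (by simp [h]))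
          · exact hF2s j p q hp hq
              (fun w hw => Finset.mem_sdiff.2 ⟨hpS w hw, fun h => hsj ((p1 w hw).1 h)⟩)
              (fun w hw => Finset.mem_sdiff.2 ⟨hqS w hw, fun h => hsj ((q1 w hw).1 h)⟩)
              (fun e he h => hpF e he (by simp [h])) (fun e he h => hqF e he (by simp [h]))
        · obtain ⟨u, v, he, hu, hv, had, hB, hB'⟩ := exists_cross B p hj
          obtain ⟨u2, v2, he2, hu2, hv2, had2, hB2, hB2'⟩ := exists_cross B q hj
          have k1 := hcp p hpF u v he had (hpS _ hu) (hpS _ hv) hB hB'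
          have k2 := hcp q hqF u2 v2 he2 had2 (hqS _ hu2) (hqS _ hv2) hB2 hB2'
          refine ⟨_, he, ?_⟩
          rw [Finset.card_le_one.1 hK _ k1 _ k2]; exact he2

/-- normalized version: `Σ c x ≤ r` -/
lemma normalized {r : ℕ} (hr : 1 ≤ r) (c : Sym2 V → ℝ) (s t : Fin r → V) (x : Sym2 V → ℝ)
    (y : Fin r → Sym2 V → ℝ)
    (hc : ∀ e, 0 ≤ c e) (hx : ∀ e, 0 ≤ x e) (hy : ∀ i e, 0 ≤ y i e)
    (hpath : ∀ i (p : G.Walk (s i) (t i)), p.IsPath →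
        1 ≤ (p.edges.map (fun e => x e + y i e)).sum)
    (hysum : ∀ i, ∑ e ∈ G.edgeFinset, y i e ≤ 1) (hcx : ∑ e ∈ G.edgeFinset, c e * x e ≤ r) :
    ∃ F : Finset (Sym2 V), F ⊆ G.edgeFinset ∧ ∑ e ∈ F, c e ≤ 132 * Real.log (r + 1) *
            Real.log (Real.log (Real.exp 1 * (r + 1))) * r ∧
        Sep G s t Finset.univ F := by
  have hr' : (1:ℝ) ≤ r := by exact_mod_cast hr
  have hv : vol G c x s t Finset.univ ≤ 3 * r := by
    unfold vol
    have h1 : (TS s t Finset.univ).card ≤ 2 * r := by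
      refine (Finset.card_le_univ _).trans ?_
      simp; omega
    have h1' : ((TS s t Finset.univ).card : ℝ) ≤ 2 * r := by exact_mod_cast h1
    have h2 : ∑ e ∈ ES G Finset.univ, c e * x e ≤ ∑ e ∈ G.edgeFinset, c e * x e :=
      Finset.sum_le_sum_of_subset_of_nonneg (Finset.filter_subset _ _)
        (fun e _ _ => mul_nonneg (hc e) (hx e))
    linarith
  have hlog3 : 0 < Real.log (3 * r) := Real.log_pos (by linarith)
  have hLL : 0 < LL (3 * r) := Real.log_pos (by linarith)
  obtain ⟨F, hF, hFc, hFs⟩ := recursion c s t x y hc hx hy hpath hysum (11 * LL (3 * r)) (by linarith)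
    (3 * r) hv (by linarith) _ Finset.univ rfl (3 * r) (by linarith) hv
  refine ⟨F, hF, hFc.trans ?_, hFs⟩
  have hl1 : 0 < Real.log (r + 1) := Real.log_pos (by linarith)
  have e1 : Real.log (3 * r) ≤ 2 * Real.log (r + 1) := by
    have : Real.log ((r + 1 : ℝ) ^ 2) = 2 * Real.log (r + 1) := by
      rw [Real.log_pow]; norm_num
    rw [← this]
    exact Real.log_le_log (by linarith) (by nlinarith)
  have e0 : Real.log (Real.exp 1 * (r + 1)) = 1 + Real.log (r + 1) := by
    rw [Real.log_mul (Real.exp_pos 1).ne' (by linarith), Real.log_exp]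
  have e2 : LL (3 * r) ≤ 2 * Real.log (1 + Real.log (r + 1)) := by
    have : Real.log ((1 + Real.log (r + 1)) ^ 2) = 2 * Real.log (1 + Real.log (r + 1)) := by
      rw [Real.log_pow]; norm_num
    rw [← this]
    exact Real.log_le_log (by linarith) (by nlinarith)
  rw [e0]
  have e3 : LL (3 * r) * Real.log (3 * r) ≤
      (2 * Real.log (1 + Real.log (r + 1))) * (2 * Real.log (r + 1)) :=
    mul_le_mul e2 e1 hlog3.le (by linarith)
  have e4 := mul_le_mul_of_nonneg_right e3 (by linarith : (0:ℝ) ≤ 33 * r)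
  nlinarith

lemma scaled {r : ℕ} (hr : 1 ≤ r) (c : Sym2 V → ℝ) (s t : Fin r → V) (x : Sym2 V → ℝ)
    (y : Fin r → Sym2 V → ℝ)
    (hc : ∀ e, 0 ≤ c e) (hx : ∀ e, 0 ≤ x e) (hy : ∀ i e, 0 ≤ y i e)
    (hpath : ∀ i (p : G.Walk (s i) (t i)), p.IsPath →
        1 ≤ (p.edges.map (fun e => x e + y i e)).sum)
    (hysum : ∀ i, ∑ e ∈ G.edgeFinset, y i e ≤ 1) :
    ∃ F : Finset (Sym2 V), F ⊆ G.edgeFinset ∧ ∑ e ∈ F, c e ≤ 132 * Real.log (r + 1) *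
            Real.log (Real.log (Real.exp 1 * (r + 1))) * ∑ e ∈ G.edgeFinset, c e * x e ∧
        Sep G s t Finset.univ F := by
  have hr' : (1:ℝ) ≤ r := by exact_mod_cast hr
  set Q := 132 * Real.log (r + 1) * Real.log (Real.log (Real.exp 1 * (r + 1))) with hQ
  set W := ∑ e ∈ G.edgeFinset, c e * x e with hW
  have hW0 : 0 ≤ W := Finset.sum_nonneg fun e _ => mul_nonneg (hc e) (hx e)
  have hα : ∀ α : ℝ, 0 ≤ α → α * W ≤ r → ∃ F : Finset (Sym2 V), F ⊆ G.edgeFinset ∧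
      α * ∑ e ∈ F, c e ≤ Q * r ∧ Sep G s t Finset.univ F := by
    intro α h0 h1
    obtain ⟨F, h2, h3, h4⟩ := normalized hr (fun e => α * c e) s t x y
      (fun e => mul_nonneg h0 (hc e)) hx hy hpath hysum (by
        simp only [mul_assoc]; rw [← Finset.mul_sum]; exact h1)
    exact ⟨F, h2, by rw [Finset.mul_sum]; exact h3, h4⟩
  obtain ⟨Fs, hFs, hmin⟩ := (G.edgeFinset.powerset.filter (fun F => Sep G s t Finset.univ F)).exists_min_image
    (fun F => ∑ e ∈ F, c e) (by
      obtain ⟨F, h1, -, h2⟩ := hα 0 le_rfl (by linarith)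
      exact ⟨F, by simp [h1, h2, -Finset.mem_powerset, Finset.mem_powerset.2 h1]⟩)
  rw [Finset.mem_filter, Finset.mem_powerset] at hFs
  refine ⟨Fs, hFs.1, ?_, hFs.2⟩
  have hα' : ∀ α : ℝ, 0 ≤ α → α * W ≤ r → α * ∑ e ∈ Fs, c e ≤ Q * r := by
    intro α h0 h1
    obtain ⟨F, h2, h3, h4⟩ := hα α h0 h1
    have := hmin F (by rw [Finset.mem_filter, Finset.mem_powerset]; exact ⟨h2, h4⟩)
    exact (mul_le_mul_of_nonneg_left this h0).trans h3
  rcases hW0.eq_or_lt with h | h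
  · rw [← h, mul_zero]
    by_contra hpos
    push Not at hpos
    have hQ0 : 0 ≤ Q * r := by simpa using hα' 0 le_rfl (by linarith)
    have := hα' ((Q * r + 1) / ∑ e ∈ Fs, c e) (by positivity) (by rw [← h]; simp)
    rw [div_mul_cancel₀ _ hpos.ne'] at this
    linarith
  · have := hα' (r / W) (by positivity) (by rw [div_mul_cancel₀ _ h.ne'])
    rw [div_mul_eq_mul_div, div_le_iff₀ h] at this
    nlinarith

end graph

end TwoRoute

/-- Rounding guarantee for 2-route multicut: there is an absolute
constant `C > 0` such that for every instance and every feasible fractional solution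
`(x, {yⁱ})` of the 2-route multicut LP, there is an edge set `F` of cost at most
`C · ln(r+1) · ln ln(e(r+1)) · Σ_e c_e x_e` whose deletion leaves no two edge-disjoint
`sᵢ`–`tᵢ` paths, for every `i`. -/
theorem stmt_10 : ∃ C : ℝ, 0 < C ∧
    ∀ (V : Type) [Fintype V] [DecidableEq V] (G : SimpleGraph V) [DecidableRel G.Adj]
      (c : Sym2 V → ℝ) (r : ℕ) (s t : Fin r → V)
      (x : Sym2 V → ℝ) (y : Fin r → Sym2 V → ℝ),
      (∀ e, 0 ≤ c e) → (∀ e, 0 ≤ x e) → (∀ i e, 0 ≤ y i e) →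
      (∀ i (p : G.Walk (s i) (t i)), p.IsPath →
        1 ≤ (p.edges.map (fun e => x e + y i e)).sum) →
      (∀ i, ∑ e ∈ G.edgeFinset, y i e ≤ 1) →
      ∃ F : Finset (Sym2 V), ↑F ⊆ G.edgeSet ∧
        (∑ e ∈ F, c e) ≤ C * Real.log (r + 1) *
            Real.log (Real.log (Real.exp 1 * (r + 1))) *
            ∑ e ∈ G.edgeFinset, c e * x e ∧
        ∀ i, ¬ ∃ p q : (G.deleteEdges ↑F).Walk (s i) (t i),
          p.IsPath ∧ q.IsPath ∧ Disjoint p.edges.toFinset q.edges.toFinset := by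
  refine ⟨132, by norm_num, ?_⟩
  intro V _ _ G _ c r s t x y hc hx hy hpath hysum
  rcases Nat.eq_zero_or_pos r with rfl | hr
  · exact ⟨∅, by simp, by simp, fun i => i.elim0⟩
  · obtain ⟨F, h1, h2, h3⟩ := TwoRoute.scaled (G := G) hr c s t x y hc hx hy hpath (by
      intro i; convert hysum i)
    refine ⟨F, ?_, ?_, ?_⟩
    · intro e he
      have h4 := h1 (Finset.mem_coe.1 he)
      simpa using h4
    · convert h2
    · rintro i ⟨p, q, hp, hq, hd⟩
      have hle : G.deleteEdges (F : Set (Sym2 V)) ≤ G := G.deleteEdges_le _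
      have hF : ∀ (w : (G.deleteEdges (F : Set (Sym2 V))).Walk (s i) (t i)), ∀ e ∈ w.edges, e ∉ F := by
        intro w e he h
        have := w.edges_subset_edgeSet he
        rw [SimpleGraph.edgeSet_deleteEdges] at this
        exact this.2 h
      obtain ⟨e, he1, he2⟩ := h3 i (p.mapLe hle) (q.mapLe hle) (hp.mapLe hle) (hq.mapLe hle)
        (by simp) (by simp) (by simpa using hF p) (by simpa using hF q)
      rw [Finset.disjoint_left] at hd
      exact hd (List.mem_toFinset.2 (by simpa using he1)) (List.mem_toFinset.2 (by simpa using he2))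
end

section
/- Rounding guarantee for k-route multicut with unit costs: there is an absolute constant C > 0 such that the following holds. Let G=(V,E) be a finite undirected graph with unit cost on every edge, source-sink pairs (s_1,t_1),…,(s_r,t_r), an integer k ≥ 2, and a real γ > 1. Let x : E → [0,∞) and y^1,…,y^r : E → [0,∞) satisfy: for every i and every simple s_i–t_i path P in G, Σ_{e∈P}(x_e + y^i_e) ≥ 1; and Σ_e y^i_e ≤ k−1 for every i. Then there exists F ⊆ E with |F| ≤ C · (γ/(√γ−1)²) · ln(r+1) · ln ln(e(r+1)) · Σ_e x_e such that for every i, every family of pairwise edge-disjoint s_i–t_i paths in (V, E\F) has fewer than γ(k−1) members (i.e., each pair is less than γ(k−1)-edge-connected). In particular, taking γ = k/(k−1) yields a feasible k-route multicut solution of cost O((k−1)² ln r ln ln r) times the LP value. -/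
namespace KR

lemma mvt (f f' : ℝ → ℝ) (hm : ∀ u v, 0 ≤ u → u ≤ v → v < 1 → f u ≤ f v)
    (hd : ∀ u, 0 ≤ u → u < 1 → HasDerivWithinAt f (f' u) (Set.Ici u) u)
    (h1 : ∀ u, 0 ≤ u → u < 1 → 1 ≤ f' u) (b : ℝ) (hb : 0 ≤ b) (hb1 : b < 1) :
    b ≤ f b - f 0 := by
  by_contra hcon
  push Not at hcon
  have hb0 : 0 < b := by
    rcases hb.lt_or_eq with h | h
    · exact h
    · subst h; simp at hcon
  obtain ⟨q, hq1, hq2⟩ : ∃ q, (f b - f 0) / b < q ∧ q < 1 :=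
    exists_between ((div_lt_one hb0).2 hcon)
  have hq0 : 0 ≤ q := le_trans (div_nonneg (sub_nonneg.2 (hm 0 b le_rfl hb hb1)) hb) hq1.le
  rw [div_lt_iff₀ hb0] at hq1
  let T : Set ℝ := {u | 0 ≤ u ∧ u ≤ b ∧ f 0 + q * u ≤ f u}
  have hT0 : (0 : ℝ) ∈ T := ⟨le_rfl, hb, by simp⟩
  have hbd : BddAbove T := ⟨b, fun u hu => hu.2.1⟩
  set c := sSup T with hc
  have hc0 : 0 ≤ c := le_csSup hbd hT0
  have hcb : c ≤ b := csSup_le ⟨0, hT0⟩ (fun u hu => hu.2.1)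
  have hcT : f 0 + q * c ≤ f c := by
    have : ∀ ε > 0, f 0 + q * c ≤ f c + ε := by
      intro ε hε
      obtain ⟨u, hu, hul⟩ := exists_lt_of_lt_csSup ⟨0, hT0⟩ (show c - ε < sSup T by linarith)
      have h1 := hm u c hu.1 (le_csSup hbd hu) (by linarith)
      have h2 := hu.2.2
      nlinarith
    exact le_of_forall_pos_le_add this
  have hcltb : c < b := by
    rcases hcb.lt_or_eq with h | h
    · exact h
    · rw [h] at hcT; linarith
  have hder := (hd c hc0 (by linarith))
  have hder2 := (hasDerivWithinAt_iff_tendsto_slope' (by simp)).1 (hder.mono Set.Ioi_subset_Ici_self)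
  have ev1 := hder2.eventually (lt_mem_nhds (lt_of_lt_of_le hq2 (h1 c hc0 (by linarith))))
  have ev2 : ∀ᶠ u in nhdsWithin c (Set.Ioi c), u < b :=
    mem_nhdsWithin_of_mem_nhds (Iio_mem_nhds hcltb)
  have ev3 : ∀ᶠ u in nhdsWithin c (Set.Ioi c), c < u := self_mem_nhdsWithin
  obtain ⟨u, hu1, hu2, hu3⟩ := (ev1.and (ev2.and ev3)).exists
  rw [slope_def_field, lt_div_iff₀ (by linarith)] at hu1
  have huT : u ∈ T := ⟨by linarith, hu2.le, by nlinarith⟩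
  have := le_csSup hbd huT
  linarith

noncomputable def gg (a b l z r : ℝ) : ℝ := if r < a then 0 else z - z / l * max (b - r) 0

lemma gg_zero {a b l z r : ℝ} (h : r < a) : gg a b l z r = 0 := by simp [gg, h]

lemma gg_one {a b l z r : ℝ} (hab : a ≤ b) (h : b ≤ r) : gg a b l z r = z := by
  have : ¬ r < a := by linarith
  simp [gg, this, max_eq_right (sub_nonpos.2 h)]

lemma gg_nonneg {a b l z r : ℝ} (hz : 0 ≤ z) (hl : b - a ≤ l) (hab : a ≤ b) :
    0 ≤ gg a b l z r := by
  unfold gg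
  split_ifs with h
  · rfl
  · push Not at h
    have hl0 : 0 ≤ l := by linarith
    have : z / l * max (b - r) 0 ≤ z := by
      calc z / l * max (b - r) 0 ≤ z / l * l := by
            gcongr; exact max_le (by linarith) hl0
        _ ≤ z := by
            rcases hl0.lt_or_eq with h0 | h0
            · rw [div_mul_cancel₀ _ h0.ne']
            · rw [← h0]; simpa using hz
    linarith

lemma gg_le {a b l z r : ℝ} (hz : 0 ≤ z) (hl : b - a ≤ l) (hab : a ≤ b) :
    gg a b l z r ≤ z := by
  unfold gg
  split_ifs with h
  · exact hz
  · have hl0 : 0 ≤ l := by linarith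
    have : 0 ≤ z / l * max (b - r) 0 := by positivity
    linarith

lemma gg_mono {a b l z : ℝ} (hz : 0 ≤ z) (hl : b - a ≤ l) (hab : a ≤ b) :
    Monotone (gg a b l z) := by
  intro r r' hr
  by_cases h : r < a
  · rw [gg_zero h]; exact gg_nonneg hz hl hab
  · have h' : ¬ r' < a := by linarith
    have hl0 : 0 ≤ l := by linarith
    simp only [gg, h, h', if_false]
    gcongr

lemma gg_deriv {a b l z r : ℝ} (hab : a ≤ b) :
    HasDerivWithinAt (gg a b l z) (if a ≤ r ∧ r < b then z / l else 0) (Set.Ici r) r := by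
  by_cases h : r < a
  · have h1 : ¬ (a ≤ r ∧ r < b) := fun h' => by linarith [h'.1]
    rw [if_neg h1]
    apply HasDerivAt.hasDerivWithinAt
    apply (hasDerivAt_const r (0:ℝ)).congr_of_eventuallyEq
    filter_upwards [Iio_mem_nhds h] with u hu
    exact gg_zero hu
  · push Not at h
    by_cases h2 : r < b
    · rw [if_pos ⟨h, h2⟩]
      have : HasDerivWithinAt (fun u => z - z / l * (b - u)) (z / l) (Set.Ici r) r := by
        have := (((hasDerivAt_id r).const_sub b).const_mul (z / l)).const_sub z
        simpa using this.hasDerivWithinAt (s := Set.Ici r)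
      apply this.congr_of_eventuallyEq
      · filter_upwards [self_mem_nhdsWithin, mem_nhdsWithin_of_mem_nhds (Iio_mem_nhds h2)]
          with u hu hu2
        have : ¬ u < a := by
          have : r ≤ u := hu
          linarith
        have h3 : 0 ≤ b - u := by have : u < b := hu2; linarith
        simp [gg, this, max_eq_left h3]
      · have h3 : 0 ≤ b - r := by linarith
        simp [gg, not_lt.2 h, max_eq_left h3]
    · rw [if_neg (fun h' => h2 h'.2)]
      push Not at h2
      apply (hasDerivWithinAt_const r (Set.Ici r) z).congr_of_mem
      · intro u hu
        exact gg_one hab (le_trans h2 hu)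
      · simp

lemma step_deriv (c r z : ℝ) :
    HasDerivWithinAt (fun u => if c ≤ u then z else 0) 0 (Set.Ici r) r := by
  by_cases h : c ≤ r
  · apply (hasDerivWithinAt_const r (Set.Ici r) z).congr_of_mem
    · intro u hu
      have : c ≤ u := le_trans h hu
      simp [this]
    · simp
  · push Not at h
    apply HasDerivAt.hasDerivWithinAt
    apply (hasDerivAt_const r (0:ℝ)).congr_of_eventuallyEq
    filter_upwards [Iio_mem_nhds h] with u hu
    have : ¬ c ≤ u := not_le.2 hu
    simp [this]

/-- potential -/
noncomputable def Phi (σ v : ℝ) : ℝ := v * Real.log (v / σ)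

lemma Phi_mono {σ u v : ℝ} (hσ : 0 < σ) (hu : σ ≤ u) (huv : u ≤ v) : Phi σ u ≤ Phi σ v := by
  unfold Phi
  have h1 : 0 ≤ Real.log (u / σ) := Real.log_nonneg ((one_le_div hσ).2 hu)
  have h2 : 0 < u := by linarith
  have h3 : Real.log (u / σ) ≤ Real.log (v / σ) :=
    Real.log_le_log (by positivity) (by gcongr)
  exact mul_le_mul huv h3 h1 (by linarith)

lemma Phi_nonneg {σ u : ℝ} (hσ : 0 < σ) (hu : σ ≤ u) : 0 ≤ Phi σ u :=
  mul_nonneg (by linarith) (Real.log_nonneg ((one_le_div hσ).2 hu))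

/-- the half of the growth function -/
noncomputable def psi (V w : ℝ) : ℝ := Real.log (1 + Real.log (V / w))

noncomputable def Psi (V w : ℝ) : ℝ := 2 * (psi V (V - w) - psi V w)

lemma psi_anti {V u w : ℝ} (hu : 0 < u) (huw : u ≤ w) (hw : w ≤ V) : psi V w ≤ psi V u := by
  unfold psi
  have hw0 : 0 < w := by linarith
  have h0 : 0 ≤ Real.log (V / w) := Real.log_nonneg ((one_le_div hw0).2 hw)
  have hV : 0 < V := by linarith
  gcongr

lemma psi_nonneg {V w : ℝ} (hw0 : 0 < w) (hw : w ≤ V) : 0 ≤ psi V w := by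
  have h0 : 0 ≤ Real.log (V / w) := Real.log_nonneg ((one_le_div hw0).2 hw)
  exact Real.log_nonneg (by linarith)

lemma psi_le {V w M : ℝ} (hw0 : 0 < w) (hw : w ≤ V) (hM : V ≤ M * w) :
    psi V w ≤ Real.log (1 + Real.log M) := by
  unfold psi
  have h0 : 0 ≤ Real.log (V / w) := Real.log_nonneg ((one_le_div hw0).2 hw)
  have hV : 0 < V := by linarith
  have : V / w ≤ M := (div_le_iff₀ hw0).2 hM
  gcongr

lemma Psi_mono {V u w : ℝ} (hu : 0 < u) (huw : u ≤ w) (hw : w < V) : Psi V u ≤ Psi V w := by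
  unfold Psi
  have h1 := psi_anti hu huw hw.le
  have h2 := psi_anti (V := V) (u := V - w) (w := V - u) (by linarith) (by linarith) (by linarith)
  linarith

lemma psi_deriv {V w : ℝ} (hw0 : 0 < w) (hw : w < V) :
    HasDerivAt (psi V) (-(1 / (w * (1 + Real.log (V / w))))) w := by
  unfold psi
  have h0 : 0 ≤ Real.log (V / w) := Real.log_nonneg ((one_le_div hw0).2 hw.le)
  have hV : 0 < V := by linarith
  have h1 : HasDerivAt (fun w => V / w) (-V / w ^ 2) w := by
    have := (hasDerivAt_const w V).fun_div (hasDerivAt_id' w) hw0.ne'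
    simpa using this
  have h2 := ((h1.log (by positivity)).const_add 1).log (by positivity)
  convert h2 using 1
  field_simp

noncomputable def hh (V w : ℝ) : ℝ := w * Real.log (V / w) + (V - w) * Real.log (V / (V - w))

lemma hh_lower {V w : ℝ} (hw0 : 0 < w) (hw : w ≤ V / 2) :
    w * (1 + Real.log (V / w)) ≤ 2 * hh V w := by
  have hV : 0 < V := by linarith
  have hVw : 0 < V - w := by linarith
  have h1 : 1 - (V / (V - w))⁻¹ ≤ Real.log (V / (V - w)) :=
    Real.one_sub_inv_le_log_of_pos (by positivity)
  have h2 : 1 - (V / (V - w))⁻¹ = w / V := by field_simp; ring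
  have h0 : 0 ≤ Real.log (V / w) := Real.log_nonneg ((one_le_div hw0).2 (by linarith))
  have h3 : (V - w) * (w / V) ≤ (V - w) * Real.log (V / (V - w)) := by
    rw [← h2]; gcongr
  have h4 : w / 2 ≤ (V - w) * (w / V) := by
    rw [mul_div_assoc', div_le_div_iff₀ (by norm_num) hV]
    nlinarith
  unfold hh
  nlinarith [mul_nonneg hw0.le h0]

lemma hh_symm (V w : ℝ) : hh V (V - w) = hh V w := by
  unfold hh; rw [sub_sub_cancel]; ring

lemma hh_pos {V w : ℝ} (hw0 : 0 < w) (hw : w < V) : 0 < hh V w := by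
  have hV : 0 < V := by linarith
  have hVw : 0 < V - w := by linarith
  have h0 : 0 < Real.log (V / w) := Real.log_pos ((one_lt_div hw0).2 (by linarith))
  have h1 : 0 < Real.log (V / (V - w)) := Real.log_pos ((one_lt_div hVw).2 (by linarith))
  unfold hh; positivity

lemma hh_Phi {σ V w : ℝ} (hσ : 0 < σ) (hw0 : 0 < w) (hw : w < V) :
    Phi σ V - Phi σ w - Phi σ (V - w) = hh V w := by
  have hV : 0 < V := by linarith
  have hVw : 0 < V - w := by linarith
  unfold Phi hh
  rw [Real.log_div hV.ne' hσ.ne', Real.log_div hw0.ne' hσ.ne', Real.log_div hVw.ne' hσ.ne',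
    Real.log_div hV.ne' hw0.ne', Real.log_div hV.ne' hVw.ne']
  ring

lemma Psi_deriv {V w : ℝ} (hw0 : 0 < w) (hw : w < V) :
    ∃ D, HasDerivAt (Psi V) D w ∧ 1 / hh V w ≤ D := by
  have hVw : 0 < V - w := by linarith
  have h1 := psi_deriv hw0 hw
  have h2 := (psi_deriv hVw (by linarith : V - w < V)).comp w ((hasDerivAt_id w).const_sub V)
  refine ⟨_, (h2.sub h1).const_mul 2, ?_⟩
  have hh0 := hh_pos hw0 hw
  have e1 : 0 ≤ Real.log (V / w) := Real.log_nonneg ((one_le_div hw0).2 (by linarith))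
  have e2 : 0 ≤ Real.log (V / (V - w)) := Real.log_nonneg ((one_le_div hVw).2 (by linarith))
  set A := w * (1 + Real.log (V / w)) with hA
  set B := (V - w) * (1 + Real.log (V / (V - w))) with hB
  have hA0 : 0 < A := by positivity
  have hB0 : 0 < B := by positivity
  have hkey : 1 / hh V w ≤ 2 * (1 / A) ∨ 1 / hh V w ≤ 2 * (1 / B) := by
    rcases le_total w (V / 2) with h | h
    · left
      have := hh_lower hw0 h
      rw [mul_one_div, div_le_div_iff₀ hh0 hA0]
      linarith
    · right
      have := hh_lower (V := V) hVw (by linarith)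
      rw [hh_symm] at this
      rw [mul_one_div, div_le_div_iff₀ hh0 hB0]
      linarith
  have : 0 < 1 / A := by positivity
  have : 0 < 1 / B := by positivity
  simp only [mul_neg, mul_one, neg_neg]
  rcases hkey with h | h <;> linarith

lemma region {ι κ : Type*} (E : Finset ι) (T : Finset κ) (x y a b : ι → ℝ) (τ : κ → ℝ)
    (σ k' q K M : ℝ) (hσ : 0 < σ) (hx : ∀ e ∈ E, 0 ≤ x e) (hy : ∀ e ∈ E, 0 ≤ y e)
    (hab : ∀ e ∈ E, a e ≤ b e) (hl : ∀ e ∈ E, b e - a e ≤ x e + y e)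
    (hk : 0 < k') (hsy : ∑ e ∈ E, y e ≤ k') (hq : 1 < q)
    (hT0 : ∃ c ∈ T, τ c ≤ 0) (hT1 : ∃ c ∈ T, 1 ≤ τ c)
    (hm : ∀ ρ, 0 ≤ ρ → ρ < 1 → q ^ 2 * k' ≤ ((E.filter (fun e => a e ≤ ρ ∧ ρ < b e)).card : ℝ))
    (hM : ∑ e ∈ E, x e + σ * T.card ≤ M * σ)
    (hM1 : 0 ≤ Real.log (1 + Real.log M))
    (hK : 4 * Real.log (1 + Real.log M) < K * (1 - 1 / q) ^ 2) :
    ∃ ρ, 0 ≤ ρ ∧ ρ < 1 ∧ ((E.filter (fun e => a e ≤ ρ ∧ ρ < b e)).card : ℝ) ≤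
      K * (Phi σ (∑ e ∈ E, x e + σ * T.card)
        - Phi σ (∑ e ∈ E.filter (fun e => b e ≤ ρ), x e + σ * (T.filter (fun c => τ c ≤ ρ)).card)
        - Phi σ (∑ e ∈ E.filter (fun e => ρ < a e), x e
            + σ * (T.filter (fun c => ρ < τ c)).card)) := by
  by_contra hcon
  push Not at hcon
  set V := ∑ e ∈ E, x e + σ * T.card with hV
  set Λ := Real.log (1 + Real.log M) with hΛ
  set α := 1 - 1 / q with hα
  have hq0 : 0 < q := by linarith
  have hα0 : 0 < α := by
    have : 1 / q < 1 := (div_lt_one hq0).2 hq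
    linarith
  have hK0 : 0 < K := by
    by_contra h
    push Not at h
    have : K * α ^ 2 ≤ 0 := mul_nonpos_of_nonpos_of_nonneg h (by positivity)
    linarith
  -- growth functions
  let W : ℝ → ℝ := fun ρ => ∑ e ∈ E, gg (a e) (b e) (x e + y e) (x e) ρ
    + ∑ c ∈ T, (if τ c ≤ ρ then σ else 0)
  let U : ℝ → ℝ := fun ρ => ∑ e ∈ E, gg (a e) (b e) (x e + y e) (y e) ρ
  have hWmono : Monotone W := by
    intro u v huv
    apply add_le_add
    · exact Finset.sum_le_sum fun e he => gg_mono (hx e he) (hl e he) (hab e he) huv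
    · apply Finset.sum_le_sum
      intro c _
      by_cases h : τ c ≤ u
      · simp [h, h.trans huv]
      · simp only [h, if_false]; split_ifs <;> linarith
  have hUmono : Monotone U := fun u v huv =>
    Finset.sum_le_sum fun e he => gg_mono (hy e he) (hl e he) (hab e he) huv
  have hU0 : ∀ ρ, 0 ≤ U ρ := fun ρ =>
    Finset.sum_nonneg fun e he => gg_nonneg (hy e he) (hl e he) (hab e he)
  have hU1 : ∀ ρ, U ρ ≤ k' := fun ρ => le_trans
    (Finset.sum_le_sum fun e he => gg_le (hy e he) (hl e he) (hab e he)) hsy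
  have hsT : ∀ ρ, ∑ c ∈ T, (if τ c ≤ ρ then σ else 0)
      = σ * (T.filter (fun c => τ c ≤ ρ)).card := by
    intro ρ
    rw [← Finset.sum_filter, Finset.sum_const, nsmul_eq_mul, mul_comm]
  have hTT : ∀ ρ, ((T.filter (fun c => τ c ≤ ρ)).card : ℝ) + (T.filter (fun c => ρ < τ c)).card
      = T.card := by
    intro ρ
    have := Finset.card_filter_add_card_filter_not (s := T) (fun c => τ c ≤ ρ)
    simp only [not_le] at this
    exact_mod_cast this
  have hV1 : ∀ ρ, ∑ e ∈ E.filter (fun e => b e ≤ ρ), x e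
      + σ * (T.filter (fun c => τ c ≤ ρ)).card ≤ W ρ := by
    intro ρ
    have : ∑ e ∈ E.filter (fun e => b e ≤ ρ), x e
        ≤ ∑ e ∈ E, gg (a e) (b e) (x e + y e) (x e) ρ := by
      rw [Finset.sum_filter]
      apply Finset.sum_le_sum
      intro e he
      split_ifs with h
      · rw [gg_one (hab e he) h]
      · exact gg_nonneg (hx e he) (hl e he) (hab e he)
    have h2 := hsT ρ
    simp only [W]
    linarith
  have hV2 : ∀ ρ, ∑ e ∈ E.filter (fun e => ρ < a e), x e
      + σ * (T.filter (fun c => ρ < τ c)).card ≤ V - W ρ := by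
    intro ρ
    have : ∑ e ∈ E.filter (fun e => ρ < a e), x e
        + ∑ e ∈ E, gg (a e) (b e) (x e + y e) (x e) ρ ≤ ∑ e ∈ E, x e := by
      rw [Finset.sum_filter, ← Finset.sum_add_distrib]
      apply Finset.sum_le_sum
      intro e he
      split_ifs with h
      · rw [gg_zero h]; simp
      · simpa using gg_le (hx e he) (hl e he) (hab e he)
    have h2 := hsT ρ
    have h3 := hTT ρ
    have h4 : σ * (T.card : ℝ) = σ * (T.filter (fun c => τ c ≤ ρ)).card
      + σ * (T.filter (fun c => ρ < τ c)).card := by rw [← h3]; ring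
    simp only [W]
    linarith
  have hS1 : ∀ ρ, 0 ≤ ρ → σ ≤ ∑ e ∈ E.filter (fun e => b e ≤ ρ), x e
      + σ * (T.filter (fun c => τ c ≤ ρ)).card := by
    intro ρ hρ
    obtain ⟨c, hc, hc0⟩ := hT0
    have h1 : (1 : ℝ) ≤ (T.filter (fun c => τ c ≤ ρ)).card := by
      exact_mod_cast Finset.card_pos.2 ⟨c, Finset.mem_filter.2 ⟨hc, hc0.trans hρ⟩⟩
    have h2 : 0 ≤ ∑ e ∈ E.filter (fun e => b e ≤ ρ), x e :=
      Finset.sum_nonneg fun e he => hx e (Finset.mem_filter.1 he).1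
    nlinarith
  have hS2 : ∀ ρ, ρ < 1 → σ ≤ ∑ e ∈ E.filter (fun e => ρ < a e), x e
      + σ * (T.filter (fun c => ρ < τ c)).card := by
    intro ρ hρ
    obtain ⟨c, hc, hc0⟩ := hT1
    have h1 : (1 : ℝ) ≤ (T.filter (fun c => ρ < τ c)).card := by
      exact_mod_cast Finset.card_pos.2 ⟨c, Finset.mem_filter.2 ⟨hc, hρ.trans_le hc0⟩⟩
    have h2 : 0 ≤ ∑ e ∈ E.filter (fun e => ρ < a e), x e :=
      Finset.sum_nonneg fun e he => hx e (Finset.mem_filter.1 he).1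
    nlinarith
  have hWl : ∀ ρ, 0 ≤ ρ → σ ≤ W ρ := fun ρ h => (hS1 ρ h).trans (hV1 ρ)
  have hWu : ∀ ρ, ρ < 1 → σ ≤ V - W ρ := fun ρ h => (hS2 ρ h).trans (hV2 ρ)
  -- derivatives
  let mx : ℝ → ℝ := fun ρ => ∑ e ∈ E, if a e ≤ ρ ∧ ρ < b e then x e / (x e + y e) else 0
  let my : ℝ → ℝ := fun ρ => ∑ e ∈ E, if a e ≤ ρ ∧ ρ < b e then y e / (x e + y e) else 0
  have hWd : ∀ ρ, HasDerivWithinAt W (mx ρ) (Set.Ici ρ) ρ := by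
    intro ρ
    have h1 : HasDerivWithinAt (fun ρ => ∑ e ∈ E, gg (a e) (b e) (x e + y e) (x e) ρ) (mx ρ)
        (Set.Ici ρ) ρ := HasDerivWithinAt.fun_sum fun e he => gg_deriv (hab e he)
    have h2 : HasDerivWithinAt (fun ρ => ∑ c ∈ T, (if τ c ≤ ρ then σ else 0)) (∑ c ∈ T, 0)
        (Set.Ici ρ) ρ := HasDerivWithinAt.fun_sum fun c hc => step_deriv (τ c) ρ σ
    have h3 := h1.add h2
    rw [Finset.sum_const_zero, add_zero] at h3
    exact h3
  have hUd : ∀ ρ, HasDerivWithinAt U (my ρ) (Set.Ici ρ) ρ := fun ρ =>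
    HasDerivWithinAt.fun_sum fun e he => gg_deriv (hab e he)
  have hmm : ∀ ρ, mx ρ + my ρ = ((E.filter (fun e => a e ≤ ρ ∧ ρ < b e)).card : ℝ) := by
    intro ρ
    rw [← Finset.sum_add_distrib, Finset.card_eq_sum_ones, Finset.sum_filter]
    push_cast
    apply Finset.sum_congr rfl
    intro e he
    split_ifs with h
    · have : 0 < x e + y e := by linarith [hl e he, h.1, h.2]
      field_simp
    · simp
  have hmx0 : ∀ ρ, 0 ≤ mx ρ := fun ρ => Finset.sum_nonneg fun e he => by
    have := hx e he
    have := hy e he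
    split_ifs <;> positivity
  have hmy0 : ∀ ρ, 0 ≤ my ρ := fun ρ => Finset.sum_nonneg fun e he => by
    have := hx e he
    have := hy e he
    split_ifs <;> positivity
  have hex : ∀ ρ, ∃ D, 0 ≤ ρ → ρ < 1 → HasDerivAt (Psi V) D (W ρ) ∧ 1 / hh V (W ρ) ≤ D := by
    intro ρ
    by_cases h : 0 ≤ ρ ∧ ρ < 1
    · obtain ⟨D, hD⟩ := Psi_deriv (V := V) (w := W ρ) (by linarith [hWl ρ h.1])
        (by linarith [hWu ρ h.2])
      exact ⟨D, fun _ _ => hD⟩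
    · exact ⟨0, fun h1 h2 => absurd ⟨h1, h2⟩ h⟩
  choose D hD using hex
  have hfin := mvt (fun ρ => Psi V (W ρ) * (α * K)⁻¹ + U ρ * (q * k')⁻¹)
    (fun ρ => D ρ * mx ρ * (α * K)⁻¹ + my ρ * (q * k')⁻¹)
    (by
      intro u v hu huv hv
      have h1 := Psi_mono (V := V) (by linarith [hWl u hu]) (hWmono huv) (by linarith [hWu v hv])
      have h2 := hUmono huv
      gcongr)
    (by
      intro u hu hu1
      have h1 := ((hD u hu hu1).1.comp_hasDerivWithinAt u (hWd u)).mul_const (α * K)⁻¹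
      exact h1.add ((hUd u).mul_const (q * k')⁻¹))
    (by
      intro ρ h0 h1
      have hh0 : 0 < hh V (W ρ) :=
        hh_pos (by linarith [hWl ρ h0]) (by linarith [hWu ρ h1])
      have hD1 := (hD ρ h0 h1).2
      have hD0 : 0 ≤ D ρ := le_trans (by positivity) hD1
      have t1 : 0 ≤ D ρ * mx ρ * (α * K)⁻¹ :=
        mul_nonneg (mul_nonneg hD0 (hmx0 ρ)) (by positivity)
      have t2 : 0 ≤ my ρ * (q * k')⁻¹ := mul_nonneg (hmy0 ρ) (by positivity)
      by_cases hc : q * k' ≤ my ρ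
      · have : 1 ≤ my ρ * (q * k')⁻¹ := by
          rw [← div_eq_mul_inv, one_le_div (by positivity)]; exact hc
        linarith
      · push Not at hc
        have c1 := hcon ρ h0 h1
        have c2 := hm ρ h0 h1
        rw [← hmm ρ] at c1 c2
        have p1 := Phi_mono hσ (hS1 ρ h0) (hV1 ρ)
        have p2 := Phi_mono hσ (hS2 ρ h1) (hV2 ρ)
        have p3 := hh_Phi hσ (V := V) (w := W ρ) (by linarith [hWl ρ h0]) (by linarith [hWu ρ h1])
        have c3 : K * hh V (W ρ) ≤ mx ρ + my ρ := by
          refine le_trans ?_ c1.le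
          apply mul_le_mul_of_nonneg_left _ hK0.le
          linarith
        have c4 : my ρ ≤ (1 / q) * (mx ρ + my ρ) := by
          rw [one_div, inv_mul_eq_div, le_div_iff₀ hq0]
          nlinarith
        have c5 : α * (mx ρ + my ρ) ≤ mx ρ := by
          rw [hα]; linarith
        have c6 : α * K * hh V (W ρ) ≤ mx ρ := by nlinarith
        have : 1 ≤ D ρ * mx ρ * (α * K)⁻¹ := by
          rw [← div_eq_mul_inv, one_le_div (by positivity)]
          calc α * K = 1 / hh V (W ρ) * (α * K * hh V (W ρ)) := by field_simp
            _ ≤ D ρ * mx ρ := by gcongr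
        linarith)
  have hPsi : ∀ ρ, 0 ≤ ρ → ρ < 1 → |Psi V (W ρ)| ≤ 2 * Λ := by
    intro ρ h0 h1
    have e1 := hWl ρ h0
    have e2 := hWu ρ h1
    have hMnn : 0 ≤ M := by
      by_contra h
      push Not at h
      nlinarith
    have a1 := psi_nonneg (V := V) (w := W ρ) (by linarith) (by linarith)
    have a2 := psi_nonneg (V := V) (w := V - W ρ) (by linarith) (by linarith)
    have a3 := psi_le (V := V) (w := W ρ) (M := M) (by linarith) (by linarith) (by nlinarith)
    have a4 := psi_le (V := V) (w := V - W ρ) (M := M) (by linarith) (by linarith) (by nlinarith)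
    unfold Psi
    rw [abs_le]
    constructor <;> linarith
  have hlt : 4 * Λ * (α * K)⁻¹ + 1 / q < 1 := by
    have : 4 * Λ * (α * K)⁻¹ < α := by
      rw [← div_eq_mul_inv, div_lt_iff₀ (by positivity)]
      nlinarith
    rw [hα] at this ⊢
    linarith
  obtain ⟨β, hβ1, hβ2⟩ := exists_between hlt
  have hβ0 : 0 ≤ β := by
    have : 0 ≤ 4 * Λ * (α * K)⁻¹ + 1 / q := by positivity
    linarith
  have := hfin β hβ0 hβ2
  have g1 := abs_le.1 (hPsi β hβ0 hβ2)
  have g2 := abs_le.1 (hPsi 0 le_rfl one_pos)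
  have g3 : (Psi V (W β) - Psi V (W 0)) * (α * K)⁻¹ ≤ 4 * Λ * (α * K)⁻¹ := by
    gcongr; linarith
  have g4 : (U β - U 0) * (q * k')⁻¹ ≤ 1 / q := by
    calc (U β - U 0) * (q * k')⁻¹ ≤ k' * (q * k')⁻¹ := by
          gcongr; linarith [hU0 0, hU1 β]
      _ = 1 / q := by field_simp
  nlinarith

section Graph
variable {V : Type} [Fintype V] [DecidableEq V] (G : SimpleGraph V) [DecidableRel G.Adj]

open Classical in
noncomputable def EA (A : Finset V) : Finset (Sym2 V) :=
  G.edgeFinset.filter (fun e => ∀ v ∈ e, v ∈ A)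

def TA {κ : Type} [Fintype κ] (loc : κ → V) (A : Finset V) : Finset κ :=
  Finset.univ.filter (fun c => loc c ∈ A)

noncomputable def vol {κ : Type} [Fintype κ] (loc : κ → V) (x : Sym2 V → ℝ) (σ : ℝ)
    (A : Finset V) : ℝ :=
  ∑ e ∈ EA G A, x e + σ * (TA loc A).card

def Many (A : Finset V) (F : Finset (Sym2 V)) (u v : V) (n : ℕ) : Prop :=
  ∃ P : Fin n → G.Walk u v, (∀ j, ∀ w ∈ (P j).support, w ∈ A) ∧
    (∀ j, ∀ e ∈ (P j).edges, e ∉ F) ∧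
    ∀ j j', j ≠ j' → Disjoint (P j).edges.toFinset (P j').edges.toFinset

variable {G}

lemma mem_EA {A : Finset V} {e : Sym2 V} :
    e ∈ EA G A ↔ e ∈ G.edgeSet ∧ ∀ v ∈ e, v ∈ A := by
  simp [EA]

lemma walk_side (d : V → ℝ) (ρ : ℝ) {u v : V} (p : G.Walk u v)
    (h : ∀ e ∈ p.edges, ¬ ((e.map d).inf ≤ ρ ∧ ρ < (e.map d).sup)) :
    ∀ w ∈ p.support, (d w ≤ ρ ↔ d u ≤ ρ) := by
  induction p with
  | nil => intro w hw; simp at hw; rw [hw]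
  | @cons u v' w' hadj p ih =>
    intro w hw
    simp only [SimpleGraph.Walk.support_cons, List.mem_cons] at hw
    have h1 := h s(u, v') (by simp)
    simp only [Sym2.map_mk, Sym2.inf_mk, Sym2.sup_mk, inf_le_iff, lt_sup_iff] at h1
    rcases hw with rfl | hw
    · rfl
    · rw [ih (fun e he => h e (by simp [he])) w hw]
      constructor
      · intro h2
        by_contra h3
        exact h1 ⟨Or.inr h2, Or.inl (not_le.1 h3)⟩
      · intro h2
        by_contra h3
        exact h1 ⟨Or.inl h2, Or.inr (not_le.1 h3)⟩

lemma edge_mem_EA {A : Finset V} {u v : V} (p : G.Walk u v) (h : ∀ w ∈ p.support, w ∈ A)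
    {e : Sym2 V} (he : e ∈ p.edges) : e ∈ EA G A := by
  rw [mem_EA]
  refine ⟨p.edges_subset_edgeSet he, ?_⟩
  induction e with
  | _ a b =>
    intro w hw
    rw [Sym2.mem_iff] at hw
    rcases hw with rfl | rfl
    · exact h _ (p.fst_mem_support_of_mem_edges he)
    · exact h _ (p.snd_mem_support_of_mem_edges he)

lemma many_le_cut (d : V → ℝ) (ρ : ℝ) {A : Finset V} {F : Finset (Sym2 V)} {u v : V} {n : ℕ}
    (hP : Many G A F u v n) (hu : d u ≤ ρ) (hv : ρ < d v) :
    n ≤ ((EA G A).filter (fun e => (e.map d).inf ≤ ρ ∧ ρ < (e.map d).sup)).card := by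
  obtain ⟨P, h1, -, h3⟩ := hP
  have : ∀ j, ∃ e ∈ (P j).edges, (e.map d).inf ≤ ρ ∧ ρ < (e.map d).sup := by
    intro j
    by_contra hc
    push Not at hc
    have := (walk_side d ρ (P j) (fun e he h => absurd h.2 (not_lt.2 (hc e he h.1))) v (by simp)).2 hu
    linarith
  choose f hf1 hf2 using this
  have hinj : Function.Injective f := by
    intro j j' hjj
    by_contra hne
    have hd := h3 j j' hne
    rw [Finset.disjoint_left] at hd
    exact hd (List.mem_toFinset.2 (hf1 j)) (by rw [hjj]; exact List.mem_toFinset.2 (hf1 j'))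
  calc n = (Finset.univ.image f).card := by
        rw [Finset.card_image_of_injective _ hinj]; simp
    _ ≤ _ := by
        apply Finset.card_le_card
        intro e he
        obtain ⟨j, -, rfl⟩ := Finset.mem_image.1 he
        exact Finset.mem_filter.2 ⟨edge_mem_EA (P j) (h1 j) (hf1 j), hf2 j⟩

lemma EA_le (d : V → ℝ) (ρ : ℝ) (A : Finset V) :
    EA G (A.filter (fun v => d v ≤ ρ)) = (EA G A).filter (fun e => (e.map d).sup ≤ ρ) := by
  ext e
  induction e with
  | _ a b => simp only [mem_EA, Finset.mem_filter, Sym2.mem_iff, forall_eq_or_imp, forall_eq,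
      Sym2.map_mk, Sym2.sup_mk, sup_le_iff]; tauto

lemma EA_gt (d : V → ℝ) (ρ : ℝ) (A : Finset V) :
    EA G (A.filter (fun v => ρ < d v)) = (EA G A).filter (fun e => ρ < (e.map d).inf) := by
  ext e
  induction e with
  | _ a b => simp only [mem_EA, Finset.mem_filter, Sym2.mem_iff, forall_eq_or_imp, forall_eq,
      Sym2.map_mk, Sym2.inf_mk, lt_inf_iff]; tauto

lemma TA_filter {κ : Type} [Fintype κ] (loc : κ → V) (p : V → Prop) [DecidablePred p]
    (A : Finset V) :
    TA loc (A.filter p) = (TA loc A).filter (fun c => p (loc c)) := by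
  ext c; simp [TA]

lemma EA_mono {A B : Finset V} (h : A ⊆ B) : EA G A ⊆ EA G B := by
  intro e; simp only [mem_EA]; exact fun he => ⟨he.1, fun v hv => h (he.2 v hv)⟩

lemma vol_mono {κ : Type} [Fintype κ] (loc : κ → V) (x : Sym2 V → ℝ) (hx : ∀ e, 0 ≤ x e)
    {σ : ℝ} (hσ : 0 ≤ σ) {A B : Finset V} (h : A ⊆ B) :
    vol G loc x σ A ≤ vol G loc x σ B := by
  unfold vol
  apply add_le_add
  · exact Finset.sum_le_sum_of_subset_of_nonneg (EA_mono h) (fun e _ _ => hx e)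
  · apply mul_le_mul_of_nonneg_left _ hσ
    have : TA loc A ⊆ TA loc B := by
      intro c; simp only [TA, Finset.mem_filter]; exact fun hc => ⟨hc.1, h hc.2⟩
    exact_mod_cast Finset.card_le_card this

lemma vol_ge {κ : Type} [Fintype κ] (loc : κ → V) (x : Sym2 V → ℝ) (hx : ∀ e, 0 ≤ x e)
    {σ : ℝ} (hσ : 0 ≤ σ) {A : Finset V} (c : κ) (hc : loc c ∈ A) :
    σ ≤ vol G loc x σ A := by
  unfold vol
  have h1 : (1 : ℝ) ≤ (TA loc A).card := by
    exact_mod_cast Finset.card_pos.2 ⟨c, by simp [TA, hc]⟩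
  have h2 : 0 ≤ ∑ e ∈ EA G A, x e := Finset.sum_nonneg fun e _ => hx e
  nlinarith

lemma many_restrict {A S : Finset V} {F F' : Finset (Sym2 V)} {u v : V} {n : ℕ}
    (h : Many G A F u v n) (hF : F' ⊆ F)
    (hS : ∀ p : G.Walk u v, (∀ w ∈ p.support, w ∈ A) → (∀ e ∈ p.edges, e ∉ F) →
      ∀ w ∈ p.support, w ∈ S) : Many G S F' u v n := by
  obtain ⟨P, h1, h2, h3⟩ := h
  exact ⟨P, fun j => hS (P j) (h1 j) (h2 j), fun j e he hf => h2 j e he (hF hf), h3⟩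

lemma main_ind {r : ℕ} (s t : Fin r → V) (x : Sym2 V → ℝ) (y : Fin r → Sym2 V → ℝ)
    (hx : ∀ e, 0 ≤ x e) (hy : ∀ i e, 0 ≤ y i e)
    (hd : ∀ i, ∃ d : V → ℝ, d (s i) ≤ 0 ∧ 1 ≤ d (t i) ∧
      ∀ u v, G.Adj u v → d v ≤ d u + (x s(u, v) + y i s(u, v)))
    (σ k' q K M : ℝ) (hσ : 0 < σ) (hk : 0 < k') (hsy : ∀ i, ∑ e ∈ G.edgeFinset, y i e ≤ k')
    (hq : 1 < q) (hK0 : 0 ≤ K) (hM1 : 0 ≤ Real.log (1 + Real.log M))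
    (hK : 4 * Real.log (1 + Real.log M) < K * (1 - 1 / q) ^ 2) :
    ∀ (N : ℕ) (A : Finset V), A.card ≤ N → σ ≤ vol G (Sum.elim s t) x σ A →
      vol G (Sum.elim s t) x σ A ≤ M * σ →
      ∃ F : Finset (Sym2 V), F ⊆ EA G A ∧
        (F.card : ℝ) ≤ K * Phi σ (vol G (Sum.elim s t) x σ A) ∧
        ∀ i n, Many G A F (s i) (t i) n → (n : ℝ) < q ^ 2 * k' := by
  intro N
  induction N with
  | zero =>
    intro A hA hV _
    have hA : A = ∅ := by simpa using hA
    refine ⟨∅, by simp, by simpa using mul_nonneg hK0 (Phi_nonneg hσ hV), ?_⟩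
    intro i n hn
    rcases Nat.eq_zero_or_pos n with rfl | h0
    · simp; positivity
    · obtain ⟨P, h1, -⟩ := hn
      have := h1 ⟨0, h0⟩ (s i) (by simp)
      simp [hA] at this
  | succ N ih =>
    intro A hA hV hVM
    by_cases hbad : ∃ i n, Many G A ∅ (s i) (t i) n ∧ q ^ 2 * k' ≤ (n : ℝ)
    swap
    · push Not at hbad
      exact ⟨∅, by simp, by simpa using mul_nonneg hK0 (Phi_nonneg hσ hV), hbad⟩
    obtain ⟨i, n, hn, hnk⟩ := hbad
    obtain ⟨d, hds, hdt, hdl⟩ := hd i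
    have hn0 : 0 < n := by
      rcases Nat.eq_zero_or_pos n with rfl | h0
      · have : 0 < q ^ 2 * k' := by positivity
        simp at hnk; linarith
      · exact h0
    have hsA : s i ∈ A := by
      obtain ⟨P, h1, -⟩ := hn
      exact h1 ⟨0, hn0⟩ (s i) (by simp)
    have htA : t i ∈ A := by
      obtain ⟨P, h1, -⟩ := hn
      exact h1 ⟨0, hn0⟩ (t i) (by simp)
    obtain ⟨ρ, hρ0, hρ1, hcut⟩ := region (EA G A) (TA (Sum.elim s t) A) x (y i)
      (fun e => (e.map d).inf) (fun e => (e.map d).sup) (fun c => d (Sum.elim s t c))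
      σ k' q K M hσ (fun e _ => hx e) (fun e _ => hy i e)
      (fun e _ => Sym2.inf_le_sup _)
      (by
        intro e he
        rw [mem_EA] at he
        induction e with
        | _ u v =>
          have hadj : G.Adj u v := he.1
          have h1 := hdl u v hadj
          have h2 := hdl v u hadj.symm
          rw [Sym2.eq_swap] at h2
          simp only [Sym2.map_mk, Sym2.inf_mk, Sym2.sup_mk]
          rcases le_total (d u) (d v) with h | h
          · rw [sup_eq_right.2 h, inf_eq_left.2 h]; linarith
          · rw [sup_eq_left.2 h, inf_eq_right.2 h]; linarith)
      hk
      (le_trans (Finset.sum_le_sum_of_subset_of_nonneg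
        (by intro e he; rw [mem_EA] at he; simpa using he.1) (fun e _ _ => hy i e)) (hsy i))
      hq
      ⟨Sum.inl i, by simp [TA, hsA], by simpa using hds⟩
      ⟨Sum.inr i, by simp [TA, htA], by simpa using hdt⟩
      (by
        intro ρ h0 h1
        refine hnk.trans ?_
        exact_mod_cast many_le_cut d ρ hn (hds.trans h0) (lt_of_lt_of_le h1 hdt))
      hVM hM1 hK
    rw [← EA_le d ρ A, ← EA_gt d ρ A, ← TA_filter (Sum.elim s t) (fun v => d v ≤ ρ) A,
      ← TA_filter (Sum.elim s t) (fun v => ρ < d v) A] at hcut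
    set S := A.filter (fun v => d v ≤ ρ) with hS
    set S' := A.filter (fun v => ρ < d v) with hS'
    set cut := (EA G A).filter (fun e => (e.map d).inf ≤ ρ ∧ ρ < (e.map d).sup) with hcutdef
    have hSA : S ⊆ A := Finset.filter_subset _ _
    have hSA' : S' ⊆ A := Finset.filter_subset _ _
    have hsS : s i ∈ S := Finset.mem_filter.2 ⟨hsA, hds.trans hρ0⟩
    have htS : t i ∈ S' := Finset.mem_filter.2 ⟨htA, lt_of_lt_of_le hρ1 hdt⟩
    have hc1 : S.card < A.card := Finset.card_lt_card (Finset.ssubset_iff_subset_ne.2 ⟨hSA, by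
      intro h
      rw [← h] at htA
      have := (Finset.mem_filter.1 htA).2
      linarith⟩)
    have hc2 : S'.card < A.card := Finset.card_lt_card (Finset.ssubset_iff_subset_ne.2 ⟨hSA', by
      intro h
      rw [← h] at hsA
      have := (Finset.mem_filter.1 hsA).2
      linarith⟩)
    obtain ⟨F1, hF1, hF1c, hF1n⟩ := ih S (by omega)
      (vol_ge _ x hx hσ.le (Sum.inl i) (by simpa using hsS))
      ((vol_mono _ x hx hσ.le hSA).trans hVM)
    obtain ⟨F2, hF2, hF2c, hF2n⟩ := ih S' (by omega)
      (vol_ge _ x hx hσ.le (Sum.inr i) (by simpa using htS))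
      ((vol_mono _ x hx hσ.le hSA').trans hVM)
    refine ⟨cut ∪ (F1 ∪ F2), ?_, ?_, ?_⟩
    · apply Finset.union_subset (Finset.filter_subset _ _)
      exact Finset.union_subset (hF1.trans (EA_mono hSA)) (hF2.trans (EA_mono hSA'))
    · have e1 : ((cut ∪ (F1 ∪ F2)).card : ℝ) ≤ cut.card + (F1.card + F2.card) := by
        have a1 := Finset.card_union_le cut (F1 ∪ F2)
        have a2 := Finset.card_union_le F1 F2
        exact_mod_cast a1.trans (by omega)
      change (cut.card : ℝ) ≤ K * (Phi σ (vol G (Sum.elim s t) x σ A)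
        - Phi σ (vol G (Sum.elim s t) x σ S) - Phi σ (vol G (Sum.elim s t) x σ S')) at hcut
      linarith
    · intro j m hm
      by_cases hj : d (s j) ≤ ρ
      · apply hF1n j m
        apply many_restrict hm
        · exact fun e he => by simp [he]
        · intro p hpA hpF w hw
          refine Finset.mem_filter.2 ⟨hpA w hw, ?_⟩
          refine (walk_side d ρ p ?_ w hw).2 hj
          intro e he h
          exact hpF e he (Finset.mem_union_left _
            (Finset.mem_filter.2 ⟨edge_mem_EA p hpA he, h⟩))
      · apply hF2n j m
        apply many_restrict hm
        · exact fun e he => by simp [he]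
        · intro p hpA hpF w hw
          refine Finset.mem_filter.2 ⟨hpA w hw, ?_⟩
          rw [← not_le]
          refine fun hcc => hj ((walk_side d ρ p ?_ w hw).1 hcc)
          intro e he h
          exact hpF e he (Finset.mem_union_left _
            (Finset.mem_filter.2 ⟨edge_mem_EA p hpA he, h⟩))

lemma exists_dist (l : Sym2 V → ℝ) (hl : ∀ e, 0 ≤ l e) (s t : V)
    (h : ∀ p : G.Walk s t, p.IsPath → 1 ≤ (p.edges.map l).sum) :
    ∃ d : V → ℝ, d s ≤ 0 ∧ 1 ≤ d t ∧ ∀ u v, G.Adj u v → d v ≤ d u + l s(u, v) := by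
  have hnn : ∀ (L : List (Sym2 V)), 0 ≤ (L.map l).sum := by
    intro L
    apply List.sum_nonneg
    intro z hz
    obtain ⟨e, -, rfl⟩ := List.mem_map.1 hz
    exact hl e
  let Z : V → Set ℝ := fun v => insert 1 {c | ∃ p : G.Walk s v, c = (p.edges.map l).sum}
  have hbd : ∀ v, BddBelow (Z v) := by
    intro v
    refine ⟨0, ?_⟩
    rintro c (rfl | ⟨p, rfl⟩)
    · norm_num
    · exact hnn _
  have hne : ∀ v, (Z v).Nonempty := fun v => ⟨1, Or.inl rfl⟩
  refine ⟨fun v => sInf (Z v), ?_, ?_, ?_⟩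
  · exact csInf_le (hbd s) (Or.inr ⟨SimpleGraph.Walk.nil, by simp⟩)
  · apply le_csInf (hne t)
    rintro c (rfl | ⟨p, rfl⟩)
    · rfl
    · refine (h p.bypass p.bypass_isPath).trans ?_
      apply List.Sublist.sum_le_sum (p.edges_bypass_sublist_edges.map l)
      intro z hz
      obtain ⟨e, -, rfl⟩ := List.mem_map.1 hz
      exact hl e
  · intro u v huv
    rw [← sub_le_iff_le_add]
    apply le_csInf (hne u)
    rintro c (rfl | ⟨p, rfl⟩)
    · have := csInf_le (hbd v) (show (1:ℝ) ∈ Z v from Or.inl rfl)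
      have := hl s(u, v)
      linarith
    · have := csInf_le (hbd v) (show ((p.concat huv).edges.map l).sum ∈ Z v from Or.inr ⟨_, rfl⟩)
      simp only [SimpleGraph.Walk.edges_concat, List.concat_eq_append, List.map_append,
        List.sum_append] at this
      simp at this
      linarith

end Graph

end KR

theorem stmt_11 : ∃ C : ℝ, 0 < C ∧
    ∀ (V : Type) [Fintype V] [DecidableEq V] (G : SimpleGraph V) [DecidableRel G.Adj]
      (r k : ℕ) (s t : Fin r → V) (γ : ℝ)
      (x : Sym2 V → ℝ) (y : Fin r → Sym2 V → ℝ),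
      2 ≤ k → 1 < γ →
      (∀ e, 0 ≤ x e) → (∀ i e, 0 ≤ y i e) →
      (∀ i (p : G.Walk (s i) (t i)), p.IsPath →
        1 ≤ (p.edges.map (fun e => x e + y i e)).sum) →
      (∀ i, ∑ e ∈ G.edgeFinset, y i e ≤ (k : ℝ) - 1) →
      ∃ F : Finset (Sym2 V), ↑F ⊆ G.edgeSet ∧
        (F.card : ℝ) ≤ C * (γ / (Real.sqrt γ - 1) ^ 2) * Real.log (r + 1) *
            Real.log (Real.log (Real.exp 1 * (r + 1))) *
            ∑ e ∈ G.edgeFinset, x e ∧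
        ∀ i (n : ℕ) (P : Fin n → (G.deleteEdges ↑F).Walk (s i) (t i)),
          (∀ j, (P j).IsPath) → Function.Injective P →
          (∀ j j', j ≠ j' → Disjoint (P j).edges.toFinset (P j').edges.toFinset) →
          (n : ℝ) < γ * ((k : ℝ) - 1) := by
  refine ⟨36, by norm_num, ?_⟩
  intro V _ _ G _ r k s t γ x y hk hγ hx hy hpath hsy
  rcases Nat.eq_zero_or_pos r with rfl | hr
  · exact ⟨∅, by simp, by simp, fun i => i.elim0⟩
  have hk' : (0 : ℝ) < (k : ℝ) - 1 := by
    have : (2 : ℝ) ≤ k := by exact_mod_cast hk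
    linarith
  set q := Real.sqrt γ with hq
  have hq2 : q ^ 2 = γ := Real.sq_sqrt (by linarith)
  have hq1 : 1 < q := by rw [hq]; exact Real.lt_sqrt_of_sq_lt (by simpa using hγ)
  have hr1 : (1 : ℝ) ≤ r := by exact_mod_cast hr
  set u := Real.log ((r : ℝ) + 1) with hu
  have hu0 : 0 < u := Real.log_pos (by linarith)
  have hl : Real.log (Real.exp 1 * ((r : ℝ) + 1)) = 1 + u := by
    rw [Real.log_mul (Real.exp_ne_zero 1) (by linarith), Real.log_exp]
  rw [hl]
  set ℓ := Real.log (1 + u) with hℓ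
  have hℓ0 : 0 < ℓ := Real.log_pos (by linarith)
  have h4r : Real.log (4 * r) ≤ 2 * u := by
    have : 2 * u = Real.log (((r : ℝ) + 1) ^ 2) := by
      rw [Real.log_pow]; push_cast; rfl
    rw [this]
    apply Real.log_le_log (by linarith)
    nlinarith [sq_nonneg ((r : ℝ) - 1)]
  have h4r0 : 0 ≤ Real.log (4 * r) := Real.log_nonneg (by linarith)
  have hΛ : Real.log (1 + Real.log (4 * r)) ≤ 2 * ℓ := by
    have : 2 * ℓ = Real.log ((1 + u) ^ 2) := by
      rw [Real.log_pow]; push_cast; rfl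
    rw [this]
    apply Real.log_le_log (by linarith)
    nlinarith [sq_nonneg u]
  set α := 1 - 1 / q with hα
  have hα0 : 0 < α := by
    have : 1 / q < 1 := (div_lt_one (by linarith)).2 hq1
    linarith
  have hαγ : γ / (q - 1) ^ 2 = 1 / α ^ 2 := by
    have h1 : q - 1 ≠ 0 := by linarith
    have h2 : α = (q - 1) / q := by rw [hα]; field_simp
    rw [h2, ← hq2]
    field_simp
  set K := 9 * ℓ / α ^ 2 with hK
  have hK0 : 0 < K := by positivity
  set X := ∑ e ∈ G.edgeFinset, x e with hX
  have hX0 : 0 ≤ X := Finset.sum_nonneg fun e _ => hx e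
  have key : ∀ σ : ℝ, 0 < σ → X ≤ 2 * r * σ → ∃ F : Finset (Sym2 V), ↑F ⊆ G.edgeSet ∧
      (F.card : ℝ) ≤ K * (8 * r * u) * σ ∧
      ∀ i (n : ℕ) (P : Fin n → (G.deleteEdges ↑F).Walk (s i) (t i)),
          (∀ j, (P j).IsPath) → Function.Injective P →
          (∀ j j', j ≠ j' → Disjoint (P j).edges.toFinset (P j').edges.toFinset) →
          (n : ℝ) < γ * ((k : ℝ) - 1) := by
    intro σ hσ hXσ
    have hvol : KR.vol G (Sum.elim s t) x σ Finset.univ ≤ 4 * r * σ := by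
      have h1 : KR.EA G Finset.univ = G.edgeFinset := by
        ext e; simp [KR.mem_EA]
      have h2 : ((KR.TA (Sum.elim s t) Finset.univ).card : ℝ) = 2 * r := by
        simp [KR.TA]; ring
      unfold KR.vol
      rw [h1, h2]
      linarith
    have hvol1 : σ ≤ KR.vol G (Sum.elim s t) x σ Finset.univ :=
      KR.vol_ge _ x hx hσ.le (Sum.inl ⟨0, hr⟩) (by simp)
    obtain ⟨F, hF1, hF2, hF3⟩ := KR.main_ind (G := G) s t x y hx hy
      (fun i => KR.exists_dist (fun e => x e + y i e) (fun e => add_nonneg (hx e) (hy i e))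
        (s i) (t i) (hpath i))
      σ ((k : ℝ) - 1) q K (4 * r) hσ hk' hsy hq1 hK0.le
      (Real.log_nonneg (by linarith))
      (by
        have : K * (1 - 1 / q) ^ 2 = 9 * ℓ := by
          rw [hK, ← hα]; field_simp
        rw [this]; linarith)
      _ Finset.univ le_rfl hvol1 hvol
    refine ⟨F, ?_, ?_, ?_⟩
    · intro e he
      exact (KR.mem_EA.1 (hF1 he)).1
    · refine hF2.trans ?_
      have h1 := KR.Phi_mono hσ hvol1 hvol
      have h2 : KR.Phi σ (4 * r * σ) ≤ (8 * r * u) * σ := by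
        unfold KR.Phi
        rw [mul_div_cancel_right₀ _ hσ.ne']
        have : 0 ≤ 4 * r * σ := by positivity
        nlinarith
      rw [mul_assoc]
      exact mul_le_mul_of_nonneg_left (h1.trans h2) hK0.le
    · intro i n P _ _ hdis
      rw [← hq2]
      apply hF3 i n
      refine ⟨fun j => (P j).mapLe (G.deleteEdges_le _), by simp, ?_, ?_⟩
      · intro j e he
        rw [SimpleGraph.Walk.edges_mapLe_eq_edges] at he
        have := (P j).edges_subset_edgeSet he
        rw [SimpleGraph.edgeSet_deleteEdges] at this
        exact fun h => this.2 h
      · intro j j' hjj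
        simpa only [SimpleGraph.Walk.edges_mapLe_eq_edges] using hdis j j' hjj
  rcases hX0.lt_or_eq with hXp | hXz
  · obtain ⟨F, h1, h2, h3⟩ := key (X / (2 * r)) (by positivity) (by
      rw [mul_div_cancel₀]; positivity)
    refine ⟨F, h1, h2.trans (le_of_eq ?_), h3⟩
    rw [hαγ, hK]
    field_simp
    norm_num
  · obtain ⟨F, h1, h2, h3⟩ := key (1 / (K * (8 * r * u) + 1)) (by positivity) (by
      rw [← hXz]; positivity)
    have hlt : (F.card : ℝ) < 1 := by
      refine lt_of_le_of_lt h2 ?_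
      rw [mul_one_div, div_lt_one (by positivity)]
      linarith
    have h0 : F.card = 0 := by
      have : F.card < 1 := by exact_mod_cast hlt
      omega
    refine ⟨F, h1, ?_, h3⟩
    rw [h0, ← hXz]; simp
end

section
/- Existence of a good radius with edge and node lengths: in the mixed edge/node region-growing setup, assume additionally that k ≥ 2 and r ≥ 1 are integers with Σ_{v∈V} y_v ≤ k−1, and that β = (Σ_e c_e x_e)/r > 0. Let V^x(S) = β + Σ_{e∈E(S)} c_e x_e, where E(S) is the set of edges with both endpoints in S. Then for every α ∈ (0,1), setting q = ⌈(k−1)/α⌉, there exists ρ₁ ∈ [0,1) satisfying simultaneously: (1) c(∂x(ρ₁)) ≤ (2/(1−α)) · Vol(ρ₁) · ln( e·V^x(S)/Vol(ρ₁) ) · ln ln( e(r+1) ); (2) c(∂x(ρ₁)) ≤ (2/(1−α)) · cVol(ρ₁) · ln( e·V^x(S)/cVol(ρ₁) ) · ln ln( e(r+1) ); and (3) |Γy(ρ₁)| < q. -/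
open scoped Classical

namespace MixedRegionGrow

variable {V : Type*}

/-- The smaller of the two values of `g` at the endpoints of an edge. -/
noncomputable def dmin (g : V → ℝ) : Sym2 V → ℝ :=
  Sym2.lift ⟨fun a b => min (g a) (g b), fun a b => min_comm _ _⟩

/-- The larger of the two values of `g` at the endpoints of an edge. -/
noncomputable def dmax (g : V → ℝ) : Sym2 V → ℝ :=
  Sym2.lift ⟨fun a b => max (g a) (g b), fun a b => max_comm _ _⟩

/-- The ball `B(ρ)` (w.r.t. the distance function `g = ℓ(z;·)`). -/
noncomputable def ball (g : V → ℝ) (S : Finset V) (ρ : ℝ) : Finset V :=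
  S.filter fun v => g v ≤ ρ

/-- The node-boundary `Γy(ρ) = {v ∈ S : ρ < ℓ(z;v) ≤ ρ + y_v}`. -/
noncomputable def gy (g : V → ℝ) (yv : V → ℝ) (S : Finset V) (ρ : ℝ) : Finset V :=
  S.filter fun v => ρ < g v ∧ g v ≤ ρ + yv v

/-- The edge-boundary
`∂x(ρ) = {(u,v) ∈ E : u, v ∈ S, ℓ(z;u) ≤ ρ, ℓ(z;v) - y_v > ρ}`. -/
noncomputable def bdx [Fintype V] [DecidableEq V] (G : SimpleGraph V) [DecidableRel G.Adj]
    (g : V → ℝ) (yv : V → ℝ) (S : Finset V) (ρ : ℝ) : Finset (Sym2 V) :=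
  G.edgeFinset.filter fun e =>
    ∃ u w, e = s(u, w) ∧ u ∈ S ∧ w ∈ S ∧ g u ≤ ρ ∧ ρ < g w - yv w

/-- `B̄(ρ) = S \ (B(ρ) ∪ Γy(ρ))`. -/
noncomputable def bbar (g : V → ℝ) (yv : V → ℝ) (S : Finset V) (ρ : ℝ) : Finset V :=
  S \ (ball g S ρ ∪ gy g yv S ρ)

/-- The volume `Vol(ρ)`; for an `∂x(ρ)`-edge the endpoint `u ∈ B(ρ)` is the one closer
to `z`, so its distance to `z` is `min` of the two endpoint distances. -/
noncomputable def vol [Fintype V] [DecidableEq V] (G : SimpleGraph V) [DecidableRel G.Adj]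
    (c x : Sym2 V → ℝ) (g : V → ℝ) (yv : V → ℝ) (S : Finset V) (β ρ : ℝ) : ℝ :=
  β + ∑ e ∈ G.edgeFinset.filter (fun e =>
        (∃ w ∈ e, w ∈ ball g S ρ) ∧ ∀ w ∈ e, w ∈ ball g S ρ ∪ gy g yv S ρ),
        c e * x e
    + ∑ e ∈ bdx G g yv S ρ, c e * (ρ - dmin g e)

/-- The complementary volume `cVol(ρ)`; for an `∂x(ρ)`-edge the far endpoint `v`
maximizes `ℓ(z;·) - y`, so the term `ℓ(z;v) - ρ - y_v` equals
`max (g - y) over the endpoints, minus ρ`. -/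
noncomputable def cvol [Fintype V] [DecidableEq V] (G : SimpleGraph V) [DecidableRel G.Adj]
    (c x : Sym2 V → ℝ) (g : V → ℝ) (yv : V → ℝ) (S : Finset V) (β ρ : ℝ) : ℝ :=
  β + ∑ e ∈ G.edgeFinset.filter (fun e =>
        (∃ w ∈ e, w ∈ bbar g yv S ρ) ∧ ∀ w ∈ e, w ∈ bbar g yv S ρ ∪ gy g yv S ρ),
        c e * x e
    + ∑ e ∈ bdx G g yv S ρ, c e * (dmax (fun w => g w - yv w) e - ρ)

noncomputable def fa (m M x ρ : ℝ) : ℝ := if ρ < m then 0 else if ρ < M then ρ - m else x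
noncomputable def fb (m M x ρ : ℝ) : ℝ := if ρ < M then (if ρ < m then x else M - ρ) else 0
noncomputable def fd (m M ρ : ℝ) : ℝ := if m ≤ ρ ∧ ρ < M then 1 else 0

noncomputable def es [Fintype V] [DecidableEq V] (G : SimpleGraph V) [DecidableRel G.Adj]
    (S : Finset V) : Finset (Sym2 V) := G.edgeFinset.filter (fun e => ∀ w ∈ e, w ∈ S)

lemma mem_bdx [Fintype V] [DecidableEq V] (G : SimpleGraph V) [DecidableRel G.Adj]
    (g yv : V → ℝ) (hyv : ∀ w, 0 ≤ yv w) (S : Finset V) (ρ : ℝ) (u v : V) :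
    (∃ a b, s(u, v) = s(a, b) ∧ a ∈ S ∧ b ∈ S ∧ g a ≤ ρ ∧ ρ < g b - yv b) ↔
      u ∈ S ∧ v ∈ S ∧ min (g u) (g v) ≤ ρ ∧ ρ < max (g u - yv u) (g v - yv v) := by
  have hu := hyv u
  have hv := hyv v
  constructor
  · rintro ⟨a, b, hab, ha, hb, h1, h2⟩
    rw [Sym2.eq_iff] at hab
    rcases hab with ⟨rfl, rfl⟩ | ⟨rfl, rfl⟩
    · exact ⟨ha, hb, min_le_of_left_le h1, lt_max_of_lt_right h2⟩
    · exact ⟨hb, ha, min_le_of_right_le h1, lt_max_of_lt_left h2⟩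
  · rintro ⟨h1, h2, h3, h4⟩
    rw [min_le_iff] at h3
    rw [lt_max_iff] at h4
    rcases h3 with h3 | h3 <;> rcases h4 with h4 | h4
    · exfalso; linarith
    · exact ⟨u, v, rfl, h1, h2, h3, h4⟩
    · exact ⟨v, u, Sym2.eq_swap, h2, h1, h3, h4⟩
    · exfalso; linarith

lemma cut_eq [Fintype V] [DecidableEq V] (G : SimpleGraph V) [DecidableRel G.Adj]
    (c : Sym2 V → ℝ) (g yv : V → ℝ) (hyv : ∀ w, 0 ≤ yv w) (S : Finset V) (ρ : ℝ) :
    ∑ e ∈ bdx G g yv S ρ, c e =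
      ∑ e ∈ es G S, c e * fd (dmin g e) (dmax (fun w => g w - yv w) e) ρ := by
  unfold bdx es
  rw [Finset.sum_filter, Finset.sum_filter]
  refine Finset.sum_congr rfl fun e _ => ?_
  induction e using Sym2.ind with
  | _ u v =>
  rw [if_congr (mem_bdx G g yv hyv S ρ u v) rfl rfl]
  simp only [Sym2.mem_iff, forall_eq_or_imp, forall_eq, fd, dmin, dmax, Sym2.lift_mk]
  split_ifs <;> grind

lemma vol_eq [Fintype V] [DecidableEq V] (G : SimpleGraph V) [DecidableRel G.Adj]
    (c x : Sym2 V → ℝ) (g yv : V → ℝ) (hyv : ∀ w, 0 ≤ yv w) (S : Finset V) (β ρ : ℝ) :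
    vol G c x g yv S β ρ = β +
      ∑ e ∈ es G S, c e * fa (dmin g e) (dmax (fun w => g w - yv w) e) (x e) ρ := by
  unfold vol bdx es
  rw [add_assoc, Finset.sum_filter, Finset.sum_filter, Finset.sum_filter, ← Finset.sum_add_distrib]
  congr 1
  refine Finset.sum_congr rfl fun e _ => ?_
  induction e using Sym2.ind with
  | _ u v =>
  have hu := hyv u
  have hv := hyv v
  rw [if_congr (mem_bdx G g yv hyv S ρ u v) rfl rfl]
  simp only [Sym2.mem_iff, forall_eq_or_imp, forall_eq, fa, dmin, dmax, Sym2.lift_mk, ball, gy,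
    Finset.mem_union, Finset.mem_filter, exists_eq_or_imp, exists_eq_left]
  by_cases h1 : u ∈ S <;> by_cases h2 : v ∈ S <;> simp only [h1, h2, true_and, false_and, and_false, and_true, or_false, false_or, if_false, if_true, add_zero]
  grind

lemma cvol_eq [Fintype V] [DecidableEq V] (G : SimpleGraph V) [DecidableRel G.Adj]
    (c x : Sym2 V → ℝ) (g yv : V → ℝ) (hyv : ∀ w, 0 ≤ yv w) (S : Finset V) (β ρ : ℝ) :
    cvol G c x g yv S β ρ = β +
      ∑ e ∈ es G S, c e * fb (dmin g e) (dmax (fun w => g w - yv w) e) (x e) ρ := by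
  unfold cvol bdx es
  rw [add_assoc, Finset.sum_filter, Finset.sum_filter, Finset.sum_filter, ← Finset.sum_add_distrib]
  congr 1
  refine Finset.sum_congr rfl fun e _ => ?_
  induction e using Sym2.ind with
  | _ u v =>
  have hu := hyv u
  have hv := hyv v
  rw [if_congr (mem_bdx G g yv hyv S ρ u v) rfl rfl]
  simp only [Sym2.mem_iff, forall_eq_or_imp, forall_eq, fb, dmin, dmax, Sym2.lift_mk, bbar, ball, gy,
    Finset.mem_union, Finset.mem_filter, Finset.mem_sdiff, exists_eq_or_imp, exists_eq_left]
  by_cases h1 : u ∈ S <;> by_cases h2 : v ∈ S <;> simp only [h1, h2, true_and, false_and, and_false, and_true, or_false, false_or, if_false, if_true, add_zero]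
  grind

lemma edge_ineq [Fintype V] [DecidableEq V] (G : SimpleGraph V) [DecidableRel G.Adj]
    (x : Sym2 V → ℝ) (yv : V → ℝ) (hx : ∀ e, 0 ≤ x e) (hyv : ∀ w, 0 ≤ yv w) (z : V)
    (ℓ : V → V → ℝ)
    (hle : ∀ u v, ∀ p : G.Walk u v, p.IsPath →
      ℓ u v ≤ (p.edges.map x).sum + (p.support.tail.map yv).sum)
    (hattain : ∀ u v, G.Reachable u v → ∃ p : G.Walk u v, p.IsPath ∧
      ℓ u v = (p.edges.map x).sum + (p.support.tail.map yv).sum)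
    (u v : V) (huv : G.Adj u v) (hu : G.Reachable z u) :
    ℓ z v - yv v ≤ ℓ z u + x s(u, v) := by
  obtain ⟨p, hp, hpe⟩ := hattain z u hu
  have h1 := hx s(u, v)
  have h2 := hyv v
  by_cases hv : v ∈ p.support
  · have := hle z v (p.takeUntil v hv) (hp.takeUntil hv)
    have h3 := congrArg (fun q : G.Walk z u => (q.edges.map x).sum + (q.support.tail.map yv).sum)
      (p.take_spec hv)
    simp only [SimpleGraph.Walk.edges_append, SimpleGraph.Walk.tail_support_append,
      List.map_append, List.sum_append] at h3
    have h4 : 0 ≤ ((p.dropUntil v hv).edges.map x).sum :=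
      List.sum_nonneg (by simp only [List.mem_map]; rintro _ ⟨e, _, rfl⟩; exact hx e)
    have h5 : 0 ≤ ((p.dropUntil v hv).support.tail.map yv).sum :=
      List.sum_nonneg (by simp only [List.mem_map]; rintro _ ⟨e, _, rfl⟩; exact hyv e)
    linarith
  · have := hle z v (p.concat huv) (hp.concat hv huv)
    rw [SimpleGraph.Walk.edges_concat, SimpleGraph.Walk.support_concat,
      List.concat_eq_append, List.tail_append_of_ne_nil (by simp)] at this
    simp only [List.map_append, List.sum_append, List.map_cons, List.map_nil, List.sum_singleton]
      at this
    linarith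

lemma edge_hyp [Fintype V] [DecidableEq V] (G : SimpleGraph V) [DecidableRel G.Adj]
    (x : Sym2 V → ℝ) (yv : V → ℝ) (hx : ∀ e, 0 ≤ x e) (hyv : ∀ w, 0 ≤ yv w) (z : V)
    (ℓ : V → V → ℝ)
    (hle : ∀ u v, ∀ p : G.Walk u v, p.IsPath →
      ℓ u v ≤ (p.edges.map x).sum + (p.support.tail.map yv).sum)
    (hattain : ∀ u v, G.Reachable u v → ∃ p : G.Walk u v, p.IsPath ∧
      ℓ u v = (p.edges.map x).sum + (p.support.tail.map yv).sum)
    (hfar : ∀ u v, ¬ G.Reachable u v → 1 + yv v < ℓ u v)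
    (e : Sym2 V) (he : e ∈ G.edgeFinset) :
    dmin (ℓ z) e ≤ 1 → dmax (fun w => ℓ z w - yv w) e - dmin (ℓ z) e ≤ x e := by
  induction e using Sym2.ind with
  | _ u v =>
  have huv : G.Adj u v := by simpa using he
  simp only [dmin, dmax, Sym2.lift_mk]
  intro h
  have hu := hyv u
  have hv := hyv v
  have hxe := hx s(u, v)
  have hr : G.Reachable z u := by
    by_contra h1
    have h2 : ¬ G.Reachable z v := fun h2 => h1 (h2.trans huv.symm.reachable)
    have h3 := hfar _ _ h1
    have h4 := hfar _ _ h2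
    rcases min_le_iff.1 h with h | h <;> linarith
  have e1 := edge_ineq G x yv hx hyv z ℓ hle hattain u v huv hr
  have e2 := edge_ineq G x yv hx hyv z ℓ hle hattain v u huv.symm (hr.trans huv.reachable)
  rw [Sym2.eq_swap] at e2
  grind

lemma fa_mono (m M x : ℝ) (hx : 0 ≤ x) (h : m ≤ 1 → M - m ≤ x) :
    MonotoneOn (fa m M x) (Set.Icc 0 1) := by
  intro a ha b hb hab
  simp only [Set.mem_Icc] at ha hb
  simp only [fa]
  grind

lemma fb_anti (m M x : ℝ) (hx : 0 ≤ x) (h : m ≤ 1 → M - m ≤ x) :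
    AntitoneOn (fb m M x) (Set.Icc 0 1) := by
  intro a ha b hb hab
  simp only [Set.mem_Icc] at ha hb
  simp only [fb]
  grind

lemma fa_bd (m M x : ℝ) (hx : 0 ≤ x) (h : m ≤ 1 → M - m ≤ x) (ρ : ℝ) (hρ : ρ ∈ Set.Icc (0 : ℝ) 1) :
    0 ≤ fa m M x ρ ∧ fa m M x ρ ≤ x := by
  simp only [Set.mem_Icc] at hρ
  simp only [fa]
  grind

lemma fb_bd (m M x : ℝ) (hx : 0 ≤ x) (h : m ≤ 1 → M - m ≤ x) (ρ : ℝ) (hρ : ρ ∈ Set.Icc (0 : ℝ) 1) :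
    0 ≤ fb m M x ρ ∧ fb m M x ρ ≤ x := by
  simp only [Set.mem_Icc] at hρ
  simp only [fb]
  grind

lemma fa_deriv (m M x ρ : ℝ) (h1 : ρ ≠ m) (h2 : ρ ≠ M) :
    HasDerivAt (fa m M x) (fd m M ρ) ρ := by
  rcases lt_or_gt_of_ne h1 with h1 | h1
  · have : fd m M ρ = 0 := by simp [fd, h1]
    rw [this]
    refine (hasDerivAt_const ρ (0 : ℝ)).congr_of_eventuallyEq ?_
    filter_upwards [eventually_lt_nhds h1] with t ht
    simp [fa, ht]
  · rcases lt_or_gt_of_ne h2 with h2 | h2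
    · have : fd m M ρ = 1 := by simp [fd, h1.le, h2]
      rw [this]
      refine ((hasDerivAt_id ρ).sub_const m).congr_of_eventuallyEq ?_
      filter_upwards [eventually_lt_nhds h2, eventually_gt_nhds h1] with t ht ht2
      simp [fa, ht, ht2.le]
    · have : fd m M ρ = 0 := by simp [fd, h2.le]
      rw [this]
      refine (hasDerivAt_const ρ x).congr_of_eventuallyEq ?_
      filter_upwards [eventually_gt_nhds h2, eventually_gt_nhds h1] with t ht ht2
      simp [fa, ht.le, not_lt.2 ht2.le, not_lt.2 ht.le]

lemma fb_deriv (m M x ρ : ℝ) (h1 : ρ ≠ m) (h2 : ρ ≠ M) :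
    HasDerivAt (fb m M x) (-fd m M ρ) ρ := by
  rcases lt_or_gt_of_ne h2 with h2 | h2
  · rcases lt_or_gt_of_ne h1 with h1 | h1
    · have : fd m M ρ = 0 := by simp [fd, h1]
      rw [this, neg_zero]
      refine (hasDerivAt_const ρ x).congr_of_eventuallyEq ?_
      filter_upwards [eventually_lt_nhds h2, eventually_lt_nhds h1] with t ht ht2
      simp [fb, ht, ht2]
    · have : fd m M ρ = 1 := by simp [fd, h1.le, h2]
      rw [this]
      refine ((hasDerivAt_id ρ).const_sub M).congr_of_eventuallyEq ?_
      filter_upwards [eventually_lt_nhds h2, eventually_gt_nhds h1] with t ht ht2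
      simp [fb, ht, not_lt.2 ht2.le]
  · have : fd m M ρ = 0 := by simp [fd, h2.le]
    rw [this, neg_zero]
    refine (hasDerivAt_const ρ (0 : ℝ)).congr_of_eventuallyEq ?_
    filter_upwards [eventually_gt_nhds h2] with t ht
    simp [fb, not_lt.2 ht.le]

open MeasureTheory

/-- log-log potential -/
noncomputable def pot (T w : ℝ) : ℝ := Real.log (Real.log (Real.exp 1 * T / w))

lemma one_le_log {T w : ℝ} (hw : 0 < w) (hT : w ≤ T) : 1 ≤ Real.log (Real.exp 1 * T / w) := by
  rw [Real.le_log_iff_exp_le (by have := Real.exp_pos 1; have : 0 < T := hw.trans_le hT; positivity),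
    le_div_iff₀ hw]
  exact mul_le_mul_of_nonneg_left hT (Real.exp_pos 1).le

lemma pot_anti {T w w' : ℝ} (hw : 0 < w) (h : w ≤ w') (hT : w' ≤ T) : pot T w' ≤ pot T w := by
  unfold pot
  have hw' : 0 < w' := hw.trans_le h
  have hT0 : 0 < T := hw'.trans_le hT
  have h1 := one_le_log hw' hT
  refine Real.log_le_log (by linarith) (Real.log_le_log (by have := Real.exp_pos 1; positivity) ?_)
  have := Real.exp_pos 1
  gcongr

lemma pot_deriv {T : ℝ} {W : ℝ → ℝ} {d ρ : ℝ} (hw : 0 < W ρ) (hT : W ρ ≤ T)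
    (h : HasDerivAt W d ρ) :
    HasDerivAt (fun t => pot T (W t)) (-(d / (W ρ * Real.log (Real.exp 1 * T / W ρ)))) ρ := by
  unfold pot
  have hT0 : 0 < T := hw.trans_le hT
  have h1 := one_le_log hw hT
  have he := Real.exp_pos 1
  have h2 : HasDerivAt (fun t => Real.exp 1 * T / W t) (-(Real.exp 1 * T * d) / (W ρ)^2) ρ := by
    have := (hasDerivAt_const ρ (Real.exp 1 * T)).div h hw.ne'
    refine this.congr_deriv ?_
    ring
  have h3 := (h2.log (by positivity)).log (by linarith)
  convert h3 using 1
  have : Real.log (Real.exp 1 * T / W ρ) ≠ 0 := by linarith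
  field_simp

lemma core (P Q : ℝ → ℝ) (P' Q' : ℝ → ℝ) (N : ℝ → ℝ) (F : Set ℝ) (hF : F.Finite)
    (L α K q : ℝ) (hL : 0 < L) (hα0 : 0 < α) (hα1 : α < 1) (hK : 0 < K) (hq : K / α ≤ q)
    (hP : MonotoneOn P (Set.Icc 0 1)) (hQ : MonotoneOn Q (Set.Icc 0 1))
    (hPL : P 1 - P 0 ≤ L) (hQL : Q 1 - Q 0 ≤ L)
    (hPd : ∀ ρ ∈ Set.Ioo (0 : ℝ) 1, ρ ∉ F → HasDerivAt P (P' ρ) ρ)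
    (hQd : ∀ ρ ∈ Set.Ioo (0 : ℝ) 1, ρ ∉ F → HasDerivAt Q (Q' ρ) ρ)
    (hP0 : ∀ ρ ∈ Set.Ioo (0 : ℝ) 1, 0 ≤ P' ρ) (hQ0 : ∀ ρ ∈ Set.Ioo (0 : ℝ) 1, 0 ≤ Q' ρ)
    (hN0 : ∀ ρ, 0 ≤ N ρ) (hNi : IntegrableOn N (Set.Ioo 0 1)) (hN : ∫ ρ in Set.Ioo 0 1, N ρ ≤ K) :
    ∃ ρ ∈ Set.Ico (0 : ℝ) 1, P' ρ ≤ 2 / (1 - α) * L ∧ Q' ρ ≤ 2 / (1 - α) * L ∧ N ρ < q := by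
  by_contra! hcon
  have h1α : 0 < 1 - α := by linarith
  have hKα : K < K / α := by rw [lt_div_iff₀ hα0]; nlinarith
  have hq0 : 0 < q := by linarith
  have hD : ∀ R : ℝ → ℝ, MonotoneOn R (Set.Icc 0 1) → R 1 - R 0 ≤ L →
      IntegrableOn (deriv R) (Set.Ioo 0 1) ∧ ∫ ρ in Set.Ioo 0 1, deriv R ρ ≤ L := by
    intro R hR hRL
    have hR' : MonotoneOn R (Set.uIcc 0 1) := by rwa [Set.uIcc_of_le zero_le_one]
    have h1 := hR'.intervalIntegrable_deriv
    have h2 := hR'.intervalIntegral_deriv_mem_uIcc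
    have h01 : R 0 ≤ R 1 := hR (by simp) (by simp) zero_le_one
    rw [Set.uIcc_of_le (by linarith)] at h2
    rw [intervalIntegrable_iff_integrableOn_Ioo_of_le zero_le_one] at h1
    rw [intervalIntegral.integral_of_le zero_le_one, integral_Ioc_eq_integral_Ioo] at h2
    exact ⟨h1, h2.2.trans hRL⟩
  obtain ⟨iP, lP⟩ := hD P hP hPL
  obtain ⟨iQ, lQ⟩ := hD Q hQ hQL
  have hae : ∀ᵐ ρ ∂(volume.restrict (Set.Ioo (0 : ℝ) 1)), ρ ∈ Set.Ioo (0 : ℝ) 1 ∧ ρ ∉ F := by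
    have h1 : ∀ᵐ ρ ∂(volume.restrict (Set.Ioo (0 : ℝ) 1)), ρ ∉ F :=
      ae_restrict_of_ae (measure_eq_zero_iff_ae_notMem.1 (hF.measure_zero _))
    filter_upwards [h1, ae_restrict_mem measurableSet_Ioo] with ρ h1 h2 using ⟨h2, h1⟩
  set T : ℝ → ℝ := fun ρ => (1 - α) / (2 * L) * (deriv P ρ + deriv Q ρ) + 1 / q * N ρ - 1 with hTdef
  have key : ∀ ρ ∈ Set.Ioo (0 : ℝ) 1, ρ ∉ F → 0 ≤ T ρ ∧ (N ρ < q → 0 < T ρ) := by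
    intro ρ hρ hρF
    have e1 := (hPd ρ hρ hρF).deriv
    have e2 := (hQd ρ hρ hρF).deriv
    have p1 := hP0 ρ hρ
    have p2 := hQ0 ρ hρ
    have p3 := hN0 ρ
    have hc := hcon ρ ⟨hρ.1.le, hρ.2⟩
    have hN' : 0 ≤ 1 / q * N ρ := by positivity
    have hbig : ∀ a : ℝ, 2 / (1 - α) * L < a → 1 < (1 - α) / (2 * L) * a := by
      intro a ha
      have : 0 < (1 - α) / (2 * L) := by positivity
      calc 1 = (1 - α) / (2 * L) * (2 / (1 - α) * L) := by field_simp
        _ < _ := mul_lt_mul_of_pos_left ha this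
    simp only [hTdef, e1, e2]
    by_cases hN1 : N ρ < q
    · have : 2 / (1 - α) * L < P' ρ + Q' ρ := by
        by_contra! h
        have := hc (by linarith) (by linarith)
        linarith
      have := hbig _ this
      exact ⟨by linarith, fun _ => by linarith⟩
    · refine ⟨?_, fun h => absurd h hN1⟩
      have h1 : 0 ≤ (1 - α) / (2 * L) * (P' ρ + Q' ρ) := by positivity
      have h2 : 1 ≤ 1 / q * N ρ := by
        rw [one_div, ← div_eq_inv_mul, le_div_iff₀ hq0]; linarith
      linarith
  have iT : IntegrableOn T (Set.Ioo 0 1) :=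
    (((iP.add iQ).const_mul _).add (hNi.const_mul _)).sub (integrable_const 1)
  have hTint : ∫ ρ in Set.Ioo (0 : ℝ) 1, T ρ ≤ 0 := by
    have : ∫ ρ in Set.Ioo (0 : ℝ) 1, T ρ = (1 - α) / (2 * L) *
      ((∫ ρ in Set.Ioo (0 : ℝ) 1, deriv P ρ) + ∫ ρ in Set.Ioo (0 : ℝ) 1, deriv Q ρ)
        + 1 / q * (∫ ρ in Set.Ioo (0 : ℝ) 1, N ρ) - 1 := by
      have i1 : Integrable (fun ρ => deriv P ρ + deriv Q ρ) (volume.restrict (Set.Ioo (0 : ℝ) 1)) :=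
        iP.add iQ
      have i2 : Integrable (fun ρ => (1 - α) / (2 * L) * (deriv P ρ + deriv Q ρ) + 1 / q * N ρ)
          (volume.restrict (Set.Ioo (0 : ℝ) 1)) := (i1.const_mul _).add (hNi.const_mul _)
      simp only [hTdef]
      rw [integral_sub i2 (integrable_const 1),
        integral_add (i1.const_mul _) (hNi.const_mul _), integral_const_mul,
        integral_const_mul, integral_add iP iQ]
      simp
    rw [this]
    have h1 : (1 - α) / (2 * L) *
      ((∫ ρ in Set.Ioo (0 : ℝ) 1, deriv P ρ) + ∫ ρ in Set.Ioo (0 : ℝ) 1, deriv Q ρ) ≤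
        (1 - α) / (2 * L) * (2 * L) :=
      mul_le_mul_of_nonneg_left (by linarith) (by positivity)
    have h2 : (1 - α) / (2 * L) * (2 * L) = 1 - α := by field_simp
    have h3 : 1 / q * (∫ ρ in Set.Ioo (0 : ℝ) 1, N ρ) ≤ 1 / q * K :=
      mul_le_mul_of_nonneg_left hN (by positivity)
    have h4 : 1 / q * K ≤ α := by
      rw [one_div, ← div_eq_inv_mul, div_le_iff₀ hq0]
      rw [div_le_iff₀ hα0] at hq
      linarith
    linarith
  have hT0 : 0 ≤ᵐ[volume.restrict (Set.Ioo (0 : ℝ) 1)] T := by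
    filter_upwards [hae] with ρ h using (key ρ h.1 h.2).1
  have hTz := (integral_eq_zero_iff_of_nonneg_ae hT0 iT).1
    (le_antisymm hTint (integral_nonneg_of_ae hT0))
  have hNq : ∫ ρ in Set.Ioo (0 : ℝ) 1, q ≤ ∫ ρ in Set.Ioo (0 : ℝ) 1, N ρ := by
    refine integral_mono_ae (integrable_const q) hNi ?_
    filter_upwards [hae, hTz] with ρ h h2
    by_contra! h3
    have := (key ρ h.1 h.2).2 h3
    simp only [Pi.zero_apply] at h2
    linarith
  simp at hNq
  linarith

lemma nodes [Fintype V] (g yv : V → ℝ) (hyv : ∀ w, 0 ≤ yv w) (S : Finset V) (K : ℝ)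
    (h : ∑ w, yv w ≤ K) :
    IntegrableOn (fun ρ => ((gy g yv S ρ).card : ℝ)) (Set.Ioo 0 1) ∧
      ∫ ρ in Set.Ioo 0 1, ((gy g yv S ρ).card : ℝ) ≤ K := by
  have e : (fun ρ => ((gy g yv S ρ).card : ℝ)) =
      fun ρ => ∑ v ∈ S, (Set.Ico (g v - yv v) (g v)).indicator (fun _ => (1 : ℝ)) ρ := by
    funext ρ
    simp only [gy, Finset.card_filter, Nat.cast_sum, Set.indicator_apply]
    refine Finset.sum_congr rfl fun v _ => ?_
    simp only [Set.mem_Ico, Nat.cast_ite, Nat.cast_one, Nat.cast_zero]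
    refine if_congr ?_ rfl rfl
    constructor <;> rintro ⟨h1, h2⟩ <;> constructor <;> linarith
  have hi : ∀ v, Integrable ((Set.Ico (g v - yv v) (g v)).indicator (fun _ => (1 : ℝ))) volume :=
    fun v => (integrable_indicator_iff measurableSet_Ico).2 (integrableOn_const (by simp))
  rw [e]
  refine ⟨integrable_finset_sum _ fun v _ => (hi v).integrableOn, ?_⟩
  rw [integral_finset_sum _ fun v _ => (hi v).integrableOn]
  have h2 : ∑ v ∈ S, yv v ≤ ∑ w, yv w :=
    Finset.sum_le_sum_of_subset_of_nonneg (Finset.subset_univ _) fun i _ _ => hyv i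
  refine le_trans (Finset.sum_le_sum fun v _ => ?_) (h2.trans h)
  refine (setIntegral_le_integral (hi v) ?_).trans ?_
  · exact Filter.Eventually.of_forall fun ρ => Set.indicator_nonneg (fun _ _ => zero_le_one) _
  · rw [integral_indicator measurableSet_Ico]
    simp [hyv v]

/-- Existence of a good radius with edge and node lengths: in the
mixed setup, if additionally `Σ_v y_v ≤ k-1` and `β = (Σ_e c_e x_e)/r > 0`, then for
every `α ∈ (0,1)`, with `q = ⌈(k-1)/α⌉`, there is `ρ₁ ∈ [0,1)` satisfying both volume
bounds for `c(∂x(ρ₁))` (with `V^x(S) = β + Σ_{e∈E(S)} c_e x_e` and the factor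
`ln ln(e(r+1))`) and `|Γy(ρ₁)| < q`. -/
theorem stmt_14 [Fintype V] [DecidableEq V] (G : SimpleGraph V) [DecidableRel G.Adj]
    (c x : Sym2 V → ℝ) (yv : V → ℝ)
    (hc : ∀ e, 0 ≤ c e) (hx : ∀ e, 0 ≤ x e) (hyv : ∀ w, 0 ≤ yv w)
    (k r : ℕ) (hk : 2 ≤ k) (hr : 1 ≤ r)
    (hysum : ∑ w, yv w ≤ (k : ℝ) - 1)
    (β : ℝ) (hβ : β = (∑ e ∈ G.edgeFinset, c e * x e) / r) (hβpos : 0 < β)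
    (S : Finset V) (z : V)
    (ℓ : V → V → ℝ)
    (hle : ∀ u v, ∀ p : G.Walk u v, p.IsPath →
      ℓ u v ≤ (p.edges.map x).sum + (p.support.tail.map yv).sum)
    (hattain : ∀ u v, G.Reachable u v → ∃ p : G.Walk u v, p.IsPath ∧
      ℓ u v = (p.edges.map x).sum + (p.support.tail.map yv).sum)
    (hfar : ∀ u v, ¬ G.Reachable u v → 1 + yv v < ℓ u v)
    (α : ℝ) (hα0 : 0 < α) (hα1 : α < 1) :
    ∃ ρ₁ ∈ Set.Ico (0 : ℝ) 1,
      ((∑ e ∈ bdx G (ℓ z) yv S ρ₁, c e) ≤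
        2 / (1 - α) * vol G c x (ℓ z) yv S β ρ₁ *
          Real.log (Real.exp 1 *
              (β + ∑ e ∈ G.edgeFinset.filter (fun e => ∀ w ∈ e, w ∈ S), c e * x e) /
            vol G c x (ℓ z) yv S β ρ₁) *
          Real.log (Real.log (Real.exp 1 * (r + 1)))) ∧
      ((∑ e ∈ bdx G (ℓ z) yv S ρ₁, c e) ≤
        2 / (1 - α) * cvol G c x (ℓ z) yv S β ρ₁ *
          Real.log (Real.exp 1 *
              (β + ∑ e ∈ G.edgeFinset.filter (fun e => ∀ w ∈ e, w ∈ S), c e * x e) /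
            cvol G c x (ℓ z) yv S β ρ₁) *
          Real.log (Real.log (Real.exp 1 * (r + 1)))) ∧
      (gy (ℓ z) yv S ρ₁).card < ⌈((k : ℝ) - 1) / α⌉₊ := by
  set g := ℓ z with hg
  set m : Sym2 V → ℝ := dmin g with hm
  set M : Sym2 V → ℝ := dmax (fun w => g w - yv w) with hM
  have hedge : ∀ e ∈ es G S, m e ≤ 1 → M e - m e ≤ x e := fun e he =>
    edge_hyp G x yv hx hyv z ℓ hle hattain hfar e (Finset.mem_filter.1 he).1
  change ∃ ρ₁ ∈ Set.Ico (0 : ℝ) 1, ((∑ e ∈ bdx G g yv S ρ₁, c e) ≤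
        2 / (1 - α) * vol G c x g yv S β ρ₁ *
          Real.log (Real.exp 1 * (β + ∑ e ∈ es G S, c e * x e) / vol G c x g yv S β ρ₁) *
          Real.log (Real.log (Real.exp 1 * (r + 1)))) ∧
      ((∑ e ∈ bdx G g yv S ρ₁, c e) ≤
        2 / (1 - α) * cvol G c x g yv S β ρ₁ *
          Real.log (Real.exp 1 * (β + ∑ e ∈ es G S, c e * x e) / cvol G c x g yv S β ρ₁) *
          Real.log (Real.log (Real.exp 1 * (r + 1)))) ∧ _
  set T := β + ∑ e ∈ es G S, c e * x e with hT
  set L := Real.log (Real.log (Real.exp 1 * (r + 1))) with hL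
  set W : ℝ → ℝ := fun ρ => vol G c x g yv S β ρ with hW
  set U : ℝ → ℝ := fun ρ => cvol G c x g yv S β ρ with hU
  set D : ℝ → ℝ := fun ρ => ∑ e ∈ bdx G g yv S ρ, c e with hD
  have eW : W = fun ρ => β + ∑ e ∈ es G S, c e * fa (m e) (M e) (x e) ρ :=
    funext fun ρ => vol_eq G c x g yv hyv S β ρ
  have eU : U = fun ρ => β + ∑ e ∈ es G S, c e * fb (m e) (M e) (x e) ρ :=
    funext fun ρ => cvol_eq G c x g yv hyv S β ρ
  have eD : D = fun ρ => ∑ e ∈ es G S, c e * fd (m e) (M e) ρ :=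
    funext fun ρ => cut_eq G c g yv hyv S ρ
  have hr1 : (1 : ℝ) ≤ r := by exact_mod_cast hr
  have hTr : T ≤ β * (r + 1) := by
    have h1 : ∑ e ∈ es G S, c e * x e ≤ ∑ e ∈ G.edgeFinset, c e * x e :=
      Finset.sum_le_sum_of_subset_of_nonneg (Finset.filter_subset _ _)
        fun e _ _ => mul_nonneg (hc e) (hx e)
    have h2 : ∑ e ∈ G.edgeFinset, c e * x e = β * r := by
      rw [hβ]; field_simp
    rw [hT]; linarith
  have bW : ∀ ρ ∈ Set.Icc (0 : ℝ) 1, β ≤ W ρ ∧ W ρ ≤ T := by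
    intro ρ hρ
    rw [eW, hT]
    refine ⟨le_add_of_nonneg_right (Finset.sum_nonneg fun e he => ?_),
      add_le_add_right (Finset.sum_le_sum fun e he => ?_) _⟩
    · exact mul_nonneg (hc e) (fa_bd _ _ _ (hx e) (hedge e he) ρ hρ).1
    · exact mul_le_mul_of_nonneg_left (fa_bd _ _ _ (hx e) (hedge e he) ρ hρ).2 (hc e)
  have bU : ∀ ρ ∈ Set.Icc (0 : ℝ) 1, β ≤ U ρ ∧ U ρ ≤ T := by
    intro ρ hρ
    rw [eU, hT]
    refine ⟨le_add_of_nonneg_right (Finset.sum_nonneg fun e he => ?_),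
      add_le_add_right (Finset.sum_le_sum fun e he => ?_) _⟩
    · exact mul_nonneg (hc e) (fb_bd _ _ _ (hx e) (hedge e he) ρ hρ).1
    · exact mul_le_mul_of_nonneg_left (fb_bd _ _ _ (hx e) (hedge e he) ρ hρ).2 (hc e)
  have mW : MonotoneOn W (Set.Icc 0 1) := by
    intro a ha b hb hab
    rw [eW]
    exact add_le_add_right (Finset.sum_le_sum fun e he =>
      mul_le_mul_of_nonneg_left (fa_mono _ _ _ (hx e) (hedge e he) ha hb hab) (hc e)) _
  have mU : AntitoneOn U (Set.Icc 0 1) := by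
    intro a ha b hb hab
    rw [eU]
    exact add_le_add_right (Finset.sum_le_sum fun e he =>
      mul_le_mul_of_nonneg_left (fb_anti _ _ _ (hx e) (hedge e he) ha hb hab) (hc e)) _
  set F : Set ℝ := ↑((es G S).image m ∪ (es G S).image M) with hF
  have hFm : ∀ ρ, ρ ∉ F → ∀ e ∈ es G S, ρ ≠ m e ∧ ρ ≠ M e := by
    intro ρ hρ e he
    constructor
    · rintro rfl
      exact hρ (by rw [hF]; exact Finset.mem_coe.2 (Finset.mem_union_left _ (Finset.mem_image_of_mem _ he)))
    · rintro rfl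
      exact hρ (by rw [hF]; exact Finset.mem_coe.2 (Finset.mem_union_right _ (Finset.mem_image_of_mem _ he)))
  have dW : ∀ ρ, ρ ∉ F → HasDerivAt W (D ρ) ρ := by
    intro ρ hρ
    rw [eW, eD]
    exact (HasDerivAt.fun_sum fun e he =>
      (fa_deriv _ _ (x e) ρ (hFm ρ hρ e he).1 (hFm ρ hρ e he).2).const_mul (c e)).const_add β
  have dU : ∀ ρ, ρ ∉ F → HasDerivAt U (-D ρ) ρ := by
    intro ρ hρ
    rw [eU, eD]
    have := (HasDerivAt.fun_sum fun e he =>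
      (fb_deriv _ _ (x e) ρ (hFm ρ hρ e he).1 (hFm ρ hρ e he).2).const_mul (c e)).const_add β
    refine this.congr_deriv ?_
    simp
  have hD0 : ∀ ρ, 0 ≤ D ρ := fun ρ => Finset.sum_nonneg fun e _ => hc e
  have hTβ : β ≤ T := (bW 0 (by simp)).1.trans (bW 0 (by simp)).2
  have hT0 : 0 < T := hβpos.trans_le hTβ
  have he1 := Real.exp_pos 1
  have hpotT : pot T T = 0 := by
    unfold pot
    rw [mul_div_assoc, div_self hT0.ne']; simp
  have hpotβ : pot T β ≤ L := by
    unfold pot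
    have h1 := one_le_log hβpos hTβ
    refine Real.log_le_log (by linarith) (Real.log_le_log (by positivity) ?_)
    rw [mul_div_assoc]
    refine mul_le_mul_of_nonneg_left ?_ he1.le
    rw [div_le_iff₀ hβpos]; linarith
  have hLpos : 0 < L := by
    refine Real.log_pos ?_
    rw [Real.lt_log_iff_exp_lt (by positivity)]
    nlinarith
  have hpr : ∀ w, β ≤ w → w ≤ T → 0 ≤ pot T w ∧ pot T w ≤ L := fun w h1 h2 =>
    ⟨hpotT ▸ pot_anti (hβpos.trans_le h1) h2 le_rfl, (pot_anti hβpos h1 h2).trans hpotβ⟩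
  have hk2 : (2 : ℝ) ≤ k := by exact_mod_cast hk
  obtain ⟨iN, lN⟩ := nodes g yv hyv S ((k : ℝ) - 1) hysum
  have i0 : (0 : ℝ) ∈ Set.Icc (0 : ℝ) 1 := by simp
  have i1 : (1 : ℝ) ∈ Set.Icc (0 : ℝ) 1 := by simp
  have W0 := hpr _ (bW 0 i0).1 (bW 0 i0).2
  have W1 := hpr _ (bW 1 i1).1 (bW 1 i1).2
  have U0 := hpr _ (bU 0 i0).1 (bU 0 i0).2
  have U1 := hpr _ (bU 1 i1).1 (bU 1 i1).2
  have posW : ∀ ρ ∈ Set.Icc (0 : ℝ) 1, 0 < W ρ * Real.log (Real.exp 1 * T / W ρ) := by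
    intro ρ hρ
    have h1 : 0 < W ρ := hβpos.trans_le (bW ρ hρ).1
    have := one_le_log h1 (bW ρ hρ).2
    exact mul_pos h1 (by linarith)
  have posU : ∀ ρ ∈ Set.Icc (0 : ℝ) 1, 0 < U ρ * Real.log (Real.exp 1 * T / U ρ) := by
    intro ρ hρ
    have h1 : 0 < U ρ := hβpos.trans_le (bU ρ hρ).1
    have := one_le_log h1 (bU ρ hρ).2
    exact mul_pos h1 (by linarith)
  obtain ⟨ρ, hρ, h1, h2, h3⟩ := core (fun t => -pot T (W t)) (fun t => pot T (U t))
    (fun ρ => D ρ / (W ρ * Real.log (Real.exp 1 * T / W ρ)))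
    (fun ρ => D ρ / (U ρ * Real.log (Real.exp 1 * T / U ρ)))
    (fun ρ => ((gy g yv S ρ).card : ℝ)) F (Finset.finite_toSet _) L α ((k : ℝ) - 1)
    (⌈((k : ℝ) - 1) / α⌉₊ : ℝ) hLpos hα0 hα1 (by linarith) (Nat.le_ceil _)
    (fun a ha b hb hab => neg_le_neg
      (pot_anti (hβpos.trans_le (bW a ha).1) (mW ha hb hab) (bW b hb).2))
    (fun a ha b hb hab =>
      pot_anti (hβpos.trans_le (bU b hb).1) (mU ha hb hab) (bU a ha).2)
    (by linarith) (by linarith)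
    (fun ρ hρ hρF => by
      have hI := Set.Ioo_subset_Icc_self hρ
      have := (pot_deriv (hβpos.trans_le (bW ρ hI).1) (bW ρ hI).2 (dW ρ hρF)).neg
      refine this.congr_deriv (neg_neg _))
    (fun ρ hρ hρF => by
      have hI := Set.Ioo_subset_Icc_self hρ
      have := pot_deriv (hβpos.trans_le (bU ρ hI).1) (bU ρ hI).2 (dU ρ hρF)
      refine this.congr_deriv ?_
      rw [neg_div, neg_neg])
    (fun ρ hρ => div_nonneg (hD0 ρ) (posW ρ (Set.Ioo_subset_Icc_self hρ)).le)
    (fun ρ hρ => div_nonneg (hD0 ρ) (posU ρ (Set.Ioo_subset_Icc_self hρ)).le)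
    (fun ρ => Nat.cast_nonneg _) iN lN
  have hI := Set.Ico_subset_Icc_self hρ
  refine ⟨ρ, hρ, ?_, ?_, by exact_mod_cast h3⟩
  · rw [div_le_iff₀ (posW ρ hI)] at h1
    calc D ρ ≤ _ := h1
      _ = 2 / (1 - α) * W ρ * Real.log (Real.exp 1 * T / W ρ) * L := by ring
  · rw [div_le_iff₀ (posU ρ hI)] at h2
    calc D ρ ≤ _ := h2
      _ = 2 / (1 - α) * U ρ * Real.log (Real.exp 1 * T / U ρ) * L := by ring

end MixedRegionGrow
end
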